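/- Let k ≥ 2 and suppose E[ξ^{k+2}] < ∞. Then there exists a constant C > 0 such that for all t ≥ 1 and all n ∈ I: the probability under τ_n that there exist a node v and a rank ℓ ≥ k with H*(v,ℓ) ≥ t is at most C·(n·t^{−k} + √n·t^{−(k−1)}). -/

import Mathlib

/-! Finite ordered rooted (plane) trees: a tree is a finite list of its root subtrees. -/
inductive PTree : Type where
  | node : List PTree → PTree

namespace PTree

/-- the number of nodes of the tree -/
def size : PTree → ℕ
  | node ts => 1 + (ts.attach.map (fun x => size x.1)).sum
decreasing_by
  have := List.sizeOf_lt_of_mem x.2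
  simp only [node.sizeOf_spec]; omega

/-- the list of all subtrees rooted at the nodes of the tree -/
def subtrees : PTree → List PTree
  | node ts => node ts :: (ts.attach.map (fun x => subtrees x.1)).flatten
decreasing_by
  have := List.sizeOf_lt_of_mem x.2
  simp only [node.sizeOf_spec]; omega

/-- the height of the tree (maximal distance from the root to a node) -/
def height : PTree → ℕ
  | node ts => (ts.attach.map (fun x => height x.1 + 1)).foldr max 0
decreasing_by
  have := List.sizeOf_lt_of_mem x.2
  simp only [node.sizeOf_spec]; omega

/-- the number of children of the root (`ξ_ε`) -/
def rootDeg : PTree → ℕ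
  | node ts => ts.length

/-- the sizes of the subtrees rooted at the children of the root -/
def childSizes : PTree → List ℕ
  | node ts => ts.map size

/-- the sizes of the subtrees rooted at the children of the root,
sorted from largest to smallest -/
def sortedSizesDesc (T : PTree) : List ℕ :=
  T.childSizes.insertionSort (· ≥ ·)

/-- `N_k`: the `k`-th largest among the sizes of the subtrees rooted at the children
of the root (`0` if there are fewer than `k` children) -/
def Nk (k : ℕ) (T : PTree) : ℕ := (sortedSizesDesc T).getD (k - 1) 0

/-- `N_{k+} = N_k + N_{k+1} + ⋯` -/
def NkPlus (k : ℕ) (T : PTree) : ℕ := ((sortedSizesDesc T).drop (k - 1)).sum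

/-- the subtrees rooted at the nodes of the heavy path: starting at the root, always
continue to the first child of maximal subtree size -/
def heavyPath : PTree → List PTree
  | node ts =>
    node ts ::
      (match ts.attach.find? (fun x => x.1.size = ((ts.map size).foldr max 0)) with
       | some x => heavyPath x.1
       | none => [])
decreasing_by
  have := List.sizeOf_lt_of_mem x.2
  simp only [node.sizeOf_spec]; omega

end PTree

/-- `Z_k`: the number of nodes `v` of the tree whose subtree has size `k` -/
def Zk (k : ℕ) (T : PTree) : ℕ := (T.subtrees.filter (fun s => s.size = k)).length

/-- the rank (`1` = largest) of the `i`-th child (0-based) among siblings whose subtree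
sizes are given by the list `sizes`; ties are broken from left to right -/
def rankIn (sizes : List ℕ) (i : ℕ) : ℕ :=
  1 + ((List.range sizes.length).filter (fun j =>
        sizes.getD i 0 < sizes.getD j 0 ∨ (sizes.getD j 0 = sizes.getD i 0 ∧ j < i))).length

mutual
/-- the number of nodes of the `k`-heavy tree: the root together with all nodes `v` such
that `v` and every non-root ancestor of `v` has rank at most `k` among its siblings -/
def heavySize (k : ℕ) : PTree → ℕ
  | .node ts => 1 + heavySizeAux k (ts.map PTree.size) 0 ts
def heavySizeAux (k : ℕ) (sizes : List ℕ) : ℕ → List PTree → ℕ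
  | _, [] => 0
  | i, t :: rest =>
      (if rankIn sizes i ≤ k then heavySize k t else 0) + heavySizeAux k sizes (i + 1) rest
end

/-- `H*(v,ℓ)`: the height of the subtree rooted at the child of rank `ℓ` of the root of `v`
(`0` if there are fewer than `ℓ` children) -/
def Hstar : PTree → ℕ → ℕ
  | .node ts, ℓ =>
    match (List.range ts.length).find? (fun i => rankIn (ts.map PTree.size) i = ℓ) with
    | some i => (ts.getD i (.node [])).height
    | none => 0

/-- the weight of a tree: the product over all nodes `v` of `p (number of children of v)` -/
noncomputable def weight (p : ℕ → ℝ) : PTree → ℝ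
  | .node ts => p ts.length * (ts.attach.map (fun x => weight p x.1)).prod
decreasing_by
  have := List.sizeOf_lt_of_mem x.2
  simp only [PTree.node.sizeOf_spec]; omega

/-- the total weight of all trees of size `n` -/
noncomputable def treeSum (p : ℕ → ℝ) (n : ℕ) : ℝ :=
  ∑' T : {T : PTree // T.size = n}, weight p T.1

/-- the probability of the event `A` under the conditional Galton-Watson tree `τ_n` -/
noncomputable def condProb (p : ℕ → ℝ) (n : ℕ) (A : PTree → Prop) : ℝ :=
  (∑' T : {T : PTree // T.size = n ∧ A T}, weight p T.1) / treeSum p n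

/-- the expectation of `f` under the conditional Galton-Watson tree `τ_n` -/
noncomputable def condExp (p : ℕ → ℝ) (n : ℕ) (f : PTree → ℝ) : ℝ :=
  (∑' T : {T : PTree // T.size = n}, weight p T.1 * f T.1) / treeSum p n

/-- the variance of `f` under the conditional Galton-Watson tree `τ_n` -/
noncomputable def condVar (p : ℕ → ℝ) (n : ℕ) (f : PTree → ℝ) : ℝ :=
  condExp p n (fun T => f T ^ 2) - (condExp p n f) ^ 2

/-- the set `I = {n ≥ 1 : Σ_{|T| = n} w(T) > 0}` of sizes of positive probability -/
def gwSupport (p : ℕ → ℝ) : Set ℕ := {n | 1 ≤ n ∧ 0 < treeSum p n}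

/-- `P(S_m = x)` for the random walk `S_m = (ξ_1 - 1) + ⋯ + (ξ_m - 1)`, `ξ_i` i.i.d. `∼ p` -/
noncomputable def walkProb (p : ℕ → ℝ) (m : ℕ) (x : ℤ) : ℝ :=
  ∑' a : Fin m → ℕ, if (∑ i, ((a i : ℤ) - 1)) = x then ∏ i, p (a i) else 0

/-- `I_n = {1 ≤ k ≤ n : P(S_{n-k} = 0) > 0}` -/
def walkSupportIn (p : ℕ → ℝ) (n : ℕ) : Set ℕ :=
  {k | 1 ≤ k ∧ k ≤ n ∧ 0 < walkProb p (n - k) 0}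

/-- `h = gcd {i > 0 : p_i > 0}`, defined as the largest common divisor of the support -/
noncomputable def gcdSupp (p : ℕ → ℝ) : ℕ :=
  sSup {d : ℕ | 0 < d ∧ ∀ i : ℕ, 0 < i → 0 < p i → d ∣ i}

/-- `α = h / (σ √(2π))` where `σ² = Σ i² p_i - 1` -/
noncomputable def gwAlpha (p : ℕ → ℝ) : ℝ :=
  (gcdSupp p : ℝ) /
    (Real.sqrt ((∑' i : ℕ, (i : ℝ) ^ 2 * p i) - 1) * Real.sqrt (2 * Real.pi))

/-- the moment `E[ξ^m] = Σ i^m p_i` is finite -/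
def MomentFinite (p : ℕ → ℝ) (m : ℝ) : Prop :=
  Summable (fun i : ℕ => (i : ℝ) ^ m * p i)

open scoped ENNReal NNReal
open Finset

section ListSums

variable {α : Type*}

/-- `listSum w d F` is the sum of `(∏ w) * F` over all lists of length `d`. -/
noncomputable def listSum (w : α → ℝ≥0∞) : ℕ → (List α → ℝ≥0∞) → ℝ≥0∞
  | 0, F => F []
  | d + 1, F => ∑' x, w x * listSum w d (fun L => F (x :: L))

lemma listSum_mono {w : α → ℝ≥0∞} {d : ℕ} {F G : List α → ℝ≥0∞}
    (h : ∀ L, L.length = d → F L ≤ G L) : listSum w d F ≤ listSum w d G := by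
  induction d generalizing F G with
  | zero => exact h [] rfl
  | succ d ih =>
    refine ENNReal.tsum_le_tsum fun x => mul_le_mul_right (ih fun L hL => h _ ?_) _
    simp [hL]

lemma listSum_congr {w : α → ℝ≥0∞} {d : ℕ} {F G : List α → ℝ≥0∞}
    (h : ∀ L, L.length = d → F L = G L) : listSum w d F = listSum w d G :=
  le_antisymm (listSum_mono fun L hL => (h L hL).le) (listSum_mono fun L hL => (h L hL).ge)

lemma listSum_add (w : α → ℝ≥0∞) (d : ℕ) (F G : List α → ℝ≥0∞) :
    listSum w d (fun L => F L + G L) = listSum w d F + listSum w d G := by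
  induction d generalizing F G with
  | zero => rfl
  | succ d ih => simp only [listSum, ih, mul_add, ENNReal.tsum_add]

lemma listSum_mul_left (w : α → ℝ≥0∞) (d : ℕ) (a : ℝ≥0∞) (F : List α → ℝ≥0∞) :
    listSum w d (fun L => a * F L) = a * listSum w d F := by
  induction d generalizing F with
  | zero => rfl
  | succ d ih => simp only [listSum, ih, mul_left_comm _ a, ENNReal.tsum_mul_left]

lemma listSum_tsum {ι : Type*} (w : α → ℝ≥0∞) (d : ℕ) (F : ι → List α → ℝ≥0∞) :
    listSum w d (fun L => ∑' i, F i L) = ∑' i, listSum w d (F i) := by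
  induction d generalizing F with
  | zero => rfl
  | succ d ih =>
    simp only [listSum, ih, ← ENNReal.tsum_mul_left]
    rw [ENNReal.tsum_comm]

lemma listSum_zero (w : α → ℝ≥0∞) (d : ℕ) : listSum w d (fun _ => 0) = 0 := by
  induction d with
  | zero => rfl
  | succ d ih => simp [listSum, ih]

lemma listSum_append (w : α → ℝ≥0∞) (d m : ℕ) (F : List α → ℝ≥0∞) :
    listSum w d (fun L => listSum w m (fun L' => F (L ++ L'))) = listSum w (d + m) F := by
  induction d generalizing F with
  | zero => simp [listSum]
  | succ d ih =>
    rw [show d + 1 + m = (d + m) + 1 by ring]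
    simp only [listSum, List.cons_append]
    exact tsum_congr fun x => by rw [ih (fun L => F (x :: L))]

lemma listSum_prod (w u : α → ℝ≥0∞) (d : ℕ) :
    listSum w d (fun L => (L.map u).prod) = (∑' x, w x * u x) ^ d := by
  induction d with
  | zero => simp [listSum]
  | succ d ih =>
    simp only [listSum, List.map_cons, List.prod_cons, listSum_mul_left, ih, ← mul_assoc,
      ENNReal.tsum_mul_right]
    rw [pow_succ']

lemma tsum_list (w : α → ℝ≥0∞) (F : List α → ℝ≥0∞) :
    ∑' L : List α, (L.map w).prod * F L = ∑' d, listSum w d F := by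
  rw [← (List.equivSigmaTuple (α := α)).symm.tsum_eq, ENNReal.tsum_sigma']
  refine tsum_congr fun d => ?_
  change ∑' f : Fin d → α, ((List.ofFn f).map w).prod * F (List.ofFn f) = _
  induction d generalizing F with
  | zero => simp [listSum]
  | succ d ih =>
    rw [← (Fin.consEquiv (fun _ : Fin (d + 1) => α)).tsum_eq, ENNReal.tsum_prod']
    simp only [listSum, ← ih, ← ENNReal.tsum_mul_left]
    refine tsum_congr fun x => tsum_congr fun f => ?_
    simp [Fin.consEquiv, mul_assoc]

/-- All the ways to pick one entry of a list, paired with the list of the remaining entries. -/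
def picks : List α → List (α × List α)
  | [] => []
  | x :: L => (x, L) :: (picks L).map (fun q => (q.1, x :: q.2))

lemma mem_picks (L : List α) (i : ℕ) (hi : i < L.length) : (L[i], L.eraseIdx i) ∈ picks L := by
  induction L generalizing i with
  | nil => simp at hi
  | cons x L ih =>
    cases i with
    | zero => simp [picks]
    | succ i =>
      have hi' : i < L.length := by simpa using hi
      simp only [picks, List.getElem_cons_succ, List.eraseIdx_cons_succ, List.mem_cons,
        List.mem_map]
      exact Or.inr ⟨_, ih i hi', rfl⟩

lemma perm_of_mem_picks {L : List α} {q : α × List α} (h : q ∈ picks L) :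
    (q.1 :: q.2).Perm L := by
  induction L generalizing q with
  | nil => simp [picks] at h
  | cons x L ih =>
    simp only [picks, List.mem_cons, List.mem_map] at h
    rcases h with rfl | ⟨q', hq', rfl⟩
    · exact List.Perm.refl _
    · exact (List.Perm.swap _ _ _).trans ((ih hq').cons x)

lemma exists_mem_picks {L : List α} {x : α} (h : x ∈ L) : ∃ L', (x, L') ∈ picks L := by
  obtain ⟨i, hi, rfl⟩ := List.getElem_of_mem h
  exact ⟨_, mem_picks L i hi⟩

lemma listSum_picks (w : α → ℝ≥0∞) (d : ℕ) (F : α × List α → ℝ≥0∞) :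
    listSum w (d + 1) (fun L => ((picks L).map F).sum) =
      (d + 1) * ∑' x, w x * listSum w d (fun L => F (x, L)) := by
  induction d generalizing F with
  | zero => simp [listSum, picks]
  | succ d ih =>
    rw [listSum]
    simp only [picks, List.map_cons, List.sum_cons, List.map_map, Function.comp_def, listSum_add,
      mul_add, ENNReal.tsum_add]
    have h1 : ∀ x, listSum w (d + 1)
        (fun L => (List.map (fun q : α × List α => F (q.1, x :: q.2)) (picks L)).sum) =
        (d + 1) * ∑' y, w y * listSum w d (fun L => F (y, x :: L)) :=
      fun x => ih (fun q => F (q.1, x :: q.2))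
    simp only [h1]
    have h2 : ∑' x, w x * (((d : ℝ≥0∞) + 1) * ∑' y, w y * listSum w d (fun L => F (y, x :: L))) =
        (d + 1) * ∑' y, w y * listSum w (d + 1) (fun L => F (y, L)) := by
      have h3 : ∀ x, w x * (((d : ℝ≥0∞) + 1) * ∑' y, w y * listSum w d (fun L => F (y, x :: L))) =
          (d + 1) * ∑' y, w y * (w x * listSum w d (fun L => F (y, x :: L))) := fun x => by
        rw [mul_left_comm, ← ENNReal.tsum_mul_left (a := w x)]
        congr 1
        exact tsum_congr fun y => mul_left_comm _ _ _
      simp only [h3, ENNReal.tsum_mul_left, listSum]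
      rw [ENNReal.tsum_comm]
      simp only [ENNReal.tsum_mul_left]
    rw [h2]
    push_cast
    ring

/-- A binomial-type tail bound: the total weight of the lists with at least `j` entries in `s`. -/
lemma listSum_countP_le (w : α → ℝ≥0∞) (hw : ∑' x, w x ≤ 1) (s : α → Bool) (d j : ℕ) :
    listSum w d (fun L => if j ≤ L.countP s then 1 else 0) ≤
      (d * ∑' x, if s x then w x else 0) ^ j := by
  set q := ∑' x, if s x then w x else 0 with hq
  have hprob : ∀ d, listSum w d (fun _ => 1) ≤ 1 := fun d => by
    have h := listSum_prod w (fun _ => 1) d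
    simp only [List.map_const', List.prod_replicate, one_pow, mul_one] at h
    rw [h]
    exact pow_le_one₀ zero_le hw
  induction d generalizing j with
  | zero => cases j <;> simp [listSum]
  | succ d ih =>
    cases j with
    | zero => simpa using hprob (d + 1)
    | succ j =>
      have key : ∀ x, w x * listSum w d
          (fun L => if j + 1 ≤ (x :: L).countP s then 1 else 0) ≤
          (if s x then w x else 0) * (d * q) ^ j + w x * (d * q) ^ (j + 1) := fun x => by
        by_cases hx : s x
        · simp only [hx, List.countP_cons_of_pos, if_true, Nat.add_le_add_iff_right]
          exact le_add_right (mul_le_mul_right (ih j) _)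
        · simp only [hx, List.countP_cons_of_neg, Bool.false_eq_true, not_false_eq_true, if_false,
            zero_mul, zero_add]
          exact mul_le_mul_right (ih (j + 1)) _
      calc listSum w (d + 1) _ ≤ q * (d * q) ^ j + 1 * (d * q) ^ (j + 1) := by
            refine (ENNReal.tsum_le_tsum key).trans ?_
            rw [ENNReal.tsum_add, ENNReal.tsum_mul_right, ENNReal.tsum_mul_right]
            gcongr
        _ = (d * q) ^ j * ((d + 1) * q) := by ring
        _ ≤ ((d + 1 : ℕ) * q) ^ j * ((d + 1 : ℕ) * q) := by
            push_cast
            gcongr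
            exact le_self_add
        _ = _ := by rw [pow_succ]

end ListSums

section TreeBasics

lemma PTree.size_node (ts : List PTree) :
    (PTree.node ts).size = 1 + (ts.map PTree.size).sum := by
  rw [PTree.size]
  simp

lemma PTree.subtrees_node (ts : List PTree) :
    (PTree.node ts).subtrees = PTree.node ts :: ts.flatMap PTree.subtrees := by
  rw [PTree.subtrees, List.flatMap_def]
  simp

lemma PTree.le_height_node (ts : List PTree) (s : ℕ) :
    s + 1 ≤ (PTree.node ts).height ↔ ∃ x ∈ ts, s ≤ x.height := by
  rw [PTree.height]
  rw [show (ts.attach.map fun x => x.1.height + 1) = ts.map (fun x => x.height + 1) by simp]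
  induction ts with
  | nil => simp
  | cons x ts ih => simp [ih]

lemma weight_node (p : ℕ → ℝ) (ts : List PTree) :
    weight p (PTree.node ts) = p ts.length * (ts.map (weight p)).prod := by
  rw [weight]
  simp

lemma weight_nonneg {p : ℕ → ℝ} (hp : ∀ i, 0 ≤ p i) : ∀ T : PTree, 0 ≤ weight p T
  | .node ts => by
    rw [weight_node]
    refine mul_nonneg (hp _) (List.prod_nonneg fun a ha => ?_)
    obtain ⟨x, hx, rfl⟩ := List.mem_map.1 ha
    have := List.sizeOf_lt_of_mem hx
    exact weight_nonneg hp x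
termination_by T => sizeOf T
decreasing_by
  simp only [PTree.node.sizeOf_spec]; omega

/-- The weight of a tree as an extended nonnegative real. -/
noncomputable def wt (p : ℕ → ℝ) (T : PTree) : ℝ≥0∞ := ENNReal.ofReal (weight p T)

lemma wt_node {p : ℕ → ℝ} (hp : ∀ i, 0 ≤ p i) (ts : List PTree) :
    wt p (PTree.node ts) = ENNReal.ofReal (p ts.length) * (ts.map (wt p)).prod := by
  rw [wt, weight_node, ENNReal.ofReal_mul (hp _)]
  congr 1
  induction ts with
  | nil => simp
  | cons x ts ih =>
    simp only [List.map_cons, List.prod_cons, ← ih]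
    rw [ENNReal.ofReal_mul (weight_nonneg hp x)]
    rfl

/-- A tree is the list of its root subtrees. -/
def PTree.equivList : PTree ≃ List PTree where
  toFun | .node ts => ts
  invFun := .node
  left_inv := fun ⟨_⟩ => rfl
  right_inv _ := rfl

lemma tsum_wt_mul {p : ℕ → ℝ} (hp : ∀ i, 0 ≤ p i) (G : PTree → ℝ≥0∞) :
    ∑' T, wt p T * G T =
      ∑' d, ENNReal.ofReal (p d) * listSum (wt p) d (fun L => G (PTree.node L)) := by
  rw [← PTree.equivList.symm.tsum_eq]
  change ∑' L : List PTree, wt p (PTree.node L) * G (PTree.node L) = _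
  simp only [wt_node hp, mul_comm (ENNReal.ofReal (p (List.length _))), mul_assoc]
  rw [tsum_list]
  refine tsum_congr fun d => ?_
  rw [← listSum_mul_left]
  exact listSum_congr fun L hL => by rw [hL, mul_comm]

lemma PTree.one_le_size (T : PTree) : 1 ≤ T.size := by
  obtain ⟨ts⟩ := T
  rw [PTree.size_node]
  omega

lemma PTree.length_le_sum_size (L : List PTree) : L.length ≤ (L.map PTree.size).sum := by
  induction L with
  | nil => simp
  | cons x L ih =>
    have := x.one_le_size
    simp only [List.length_cons, List.map_cons, List.sum_cons]
    omega

end TreeBasics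

section WalkCoeff

/-- `walkCoeff p n N` is the coefficient of `u ^ N` in `(∑ i, p i * u ^ i) ^ n`, that is, the
probability that `n` independent variables with law `p` add up to `N`. -/
noncomputable def walkCoeff (p : ℕ → ℝ) (n N : ℕ) : ℝ :=
  PowerSeries.coeff N ((PowerSeries.mk p) ^ n)

lemma walkCoeff_zero (p : ℕ → ℝ) (N : ℕ) : walkCoeff p 0 N = if N = 0 then 1 else 0 := by
  rw [walkCoeff, pow_zero, PowerSeries.coeff_one]

lemma walkCoeff_succ (p : ℕ → ℝ) (n N : ℕ) :
    walkCoeff p (n + 1) N = ∑ d ∈ range (N + 1), p d * walkCoeff p n (N - d) := by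
  rw [walkCoeff, pow_succ', PowerSeries.coeff_mul, Finset.Nat.sum_antidiagonal_eq_sum_range_succ_mk]
  simp [walkCoeff]

lemma walkCoeff_nonneg {p : ℕ → ℝ} (hp : ∀ i, 0 ≤ p i) (n N : ℕ) : 0 ≤ walkCoeff p n N := by
  induction n generalizing N with
  | zero => rw [walkCoeff_zero]; split_ifs <;> simp
  | succ n ih =>
    rw [walkCoeff_succ]
    exact sum_nonneg fun d _ => mul_nonneg (hp d) (ih _)

lemma sum_mul_walkCoeff (p : ℕ → ℝ) (n N : ℕ) :
    ((n : ℝ) + 1) * ∑ d ∈ range (N + 1), (d : ℝ) * (p d * walkCoeff p n (N - d)) =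
      N * walkCoeff p (n + 1) N := by
  cases N with
  | zero => simp
  | succ N =>
    have h := congrArg (PowerSeries.coeff N)
      (PowerSeries.derivative_pow (PowerSeries.mk p) (n + 1))
    rw [PowerSeries.coeff_derivative] at h
    rw [sum_range_succ']
    simp only [Nat.cast_zero, zero_mul, add_zero, Nat.add_sub_add_right]
    rw [mul_comm ((N + 1 : ℕ) : ℝ), walkCoeff]
    push_cast
    rw [h, Nat.add_sub_cancel, mul_assoc, mul_comm ((PowerSeries.mk p) ^ n)]
    rw [show (((n + 1 : ℕ) : PowerSeries ℝ)) = PowerSeries.C ((n : ℝ) + 1) by simp]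
    rw [PowerSeries.coeff_C_mul, PowerSeries.coeff_mul,
      Finset.Nat.sum_antidiagonal_eq_sum_range_succ_mk]
    congr 1
    refine sum_congr rfl fun d _ => ?_
    rw [PowerSeries.coeff_derivative, PowerSeries.coeff_mk, walkCoeff]
    ring

lemma sum_add_mul_walkCoeff (p : ℕ → ℝ) (n N : ℕ) (m : ℝ) :
    ∑ d ∈ range (N + 1), p d * ((d + m) * walkCoeff p n (N - d)) =
      (m + N / (n + 1)) * walkCoeff p (n + 1) N := by
  have h := sum_mul_walkCoeff p n N
  have hn : (n : ℝ) + 1 ≠ 0 := by positivity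
  have h2 : ∑ d ∈ range (N + 1), p d * ((d + m) * walkCoeff p n (N - d)) =
      ∑ d ∈ range (N + 1), (d : ℝ) * (p d * walkCoeff p n (N - d)) +
        m * ∑ d ∈ range (N + 1), p d * walkCoeff p n (N - d) := by
    rw [mul_sum, ← sum_add_distrib]
    exact sum_congr rfl fun d _ => by ring
  rw [h2, ← walkCoeff_succ, add_mul, add_comm, div_mul_eq_mul_div, ← h, mul_div_cancel_left₀ _ hn]

end WalkCoeff

section Forests

variable {p : ℕ → ℝ}

lemma tsum_ofReal_mul_eq_sum (hp : ∀ i, 0 ≤ p i) (N : ℕ) (F : ℕ → ℝ) (hF : ∀ d, 0 ≤ F d)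
    (h0 : ∀ d, N < d → F d = 0) :
    ∑' d, ENNReal.ofReal (p d) * ENNReal.ofReal (F d) =
      ENNReal.ofReal (∑ d ∈ range (N + 1), p d * F d) := by
  rw [ENNReal.ofReal_sum_of_nonneg fun d _ => mul_nonneg (hp d) (hF d),
    tsum_eq_sum (s := range (N + 1))]
  · exact sum_congr rfl fun d _ => (ENNReal.ofReal_mul (hp d)).symm
  · intro d hd
    rw [h0 d (by simp only [mem_range] at hd; omega)]
    simp

/-- Exposing the root of the first tree of a forest. -/
lemma listSum_succ_eq (hp : ∀ i, 0 ≤ p i) (m : ℕ) (F : List PTree → ℝ≥0∞) :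
    listSum (wt p) (m + 1) F = ∑' d, ENNReal.ofReal (p d) *
      listSum (wt p) d (fun ts => listSum (wt p) m (fun L => F (PTree.node ts :: L))) := by
  rw [listSum, tsum_wt_mul hp]

/-- The total weight of the forests of `m` trees with `n` nodes. -/
noncomputable def forestWt (p : ℕ → ℝ) (n m : ℕ) : ℝ≥0∞ :=
  listSum (wt p) m (fun L => if (L.map PTree.size).sum = n then 1 else 0)

lemma forestWt_zero_left (m : ℕ) : forestWt p 0 m = if m = 0 then 1 else 0 := by
  rw [forestWt]
  split_ifs with h
  · subst h; simp [listSum]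
  · refine (listSum_congr (G := fun _ => 0) fun L hL => if_neg ?_).trans (listSum_zero _ _)
    have := PTree.length_le_sum_size L
    omega

lemma forestWt_succ_zero (n : ℕ) : forestWt p (n + 1) 0 = 0 := by
  simp [forestWt, listSum]

lemma forestWt_succ_succ (hp : ∀ i, 0 ≤ p i) (n m : ℕ) :
    forestWt p (n + 1) (m + 1) = ∑' d, ENNReal.ofReal (p d) * forestWt p n (d + m) := by
  rw [forestWt, listSum_succ_eq hp]
  refine tsum_congr fun d => ?_
  rw [forestWt, ← listSum_append]
  congr 1
  refine listSum_congr fun ts _ => listSum_congr fun L _ => ?_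
  simp only [List.map_cons, List.sum_cons, PTree.size_node, List.map_append, List.sum_append]
  congr 1
  rw [eq_iff_iff]
  omega

/-- The hitting time theorem. -/
lemma forestWt_eq (hp : ∀ i, 0 ≤ p i) (n m : ℕ) :
    forestWt p (n + 1) m = ENNReal.ofReal
      (if m ≤ n + 1 then (m : ℝ) / (n + 1) * walkCoeff p (n + 1) (n + 1 - m) else 0) := by
  induction n generalizing m with
  | zero =>
    cases m with
    | zero => simp [forestWt_succ_zero]
    | succ m =>
      rw [forestWt_succ_succ hp]
      simp only [forestWt_zero_left]
      rcases m with _ | m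
      · rw [tsum_eq_single 0 (by intro d hd; simp [hd])]
        simp [walkCoeff_succ, walkCoeff_zero]
      · simp
  | succ n ih =>
    cases m with
    | zero => simp [forestWt_succ_zero]
    | succ m =>
      rw [forestWt_succ_succ hp]
      simp only [ih]
      rw [tsum_ofReal_mul_eq_sum hp (n + 1 - m)]
      · congr 1
        split_ifs with h
        · have hm : m ≤ n + 1 := by omega
          have h1 := sum_add_mul_walkCoeff p (n + 1) (n + 1 - m) m
          have h2 : ∀ d ∈ range (n + 1 - m + 1),
              p d * (if d + m ≤ n + 1 then ((d + m : ℕ) : ℝ) / (n + 1) *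
                walkCoeff p (n + 1) (n + 1 - (d + m)) else 0) =
              (1 / ((n : ℝ) + 1)) * (p d * ((d + m) * walkCoeff p (n + 1) (n + 1 - m - d))) := by
            intro d hd
            rw [mem_range] at hd
            rw [if_pos (by omega), show n + 1 - (d + m) = n + 1 - m - d by omega]
            push_cast
            ring
          rw [sum_congr rfl h2, ← mul_sum, h1, show n + 1 + 1 - (m + 1) = n + 1 - m by omega,
            Nat.cast_sub hm]
          push_cast
          field_simp
          ring
        · refine sum_eq_zero fun d _ => ?_
          rw [if_neg (by omega), mul_zero]
      · intro d
        split_ifs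
        · exact mul_nonneg (by positivity) (walkCoeff_nonneg hp _ _)
        · exact le_rfl
      · intro d hd
        split_ifs with h
        · rw [show d + m = 0 by omega]; simp
        · rfl

/-- The total weight of the forests of `m` trees with `n` nodes, where every forest is counted
with the sum of `g` over the subtrees rooted at its nodes. -/
noncomputable def markedWt (p : ℕ → ℝ) (g : PTree → ℝ≥0∞) (n m : ℕ) : ℝ≥0∞ :=
  listSum (wt p) m (fun L => if (L.map PTree.size).sum = n then
    ((L.flatMap PTree.subtrees).map g).sum else 0)

lemma markedWt_succ_succ (hp : ∀ i, 0 ≤ p i) (g : PTree → ℝ≥0∞) (n m : ℕ) :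
    markedWt p g (n + 1) (m + 1) =
      ∑' x, wt p x * (g x * if x.size ≤ n + 1 then forestWt p (n + 1 - x.size) m else 0) +
      ∑' d, ENNReal.ofReal (p d) * markedWt p g n (d + m) := by
  have h1 : ∑' x, wt p x * (g x * if x.size ≤ n + 1 then forestWt p (n + 1 - x.size) m else 0) =
      ∑' x, wt p x * listSum (wt p) m (fun L =>
        g x * if x.size + (L.map PTree.size).sum = n + 1 then 1 else 0) := by
    refine tsum_congr fun x => ?_
    rw [listSum_mul_left]
    congr 2
    split_ifs with h
    · refine listSum_congr fun L _ => ?_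
      congr 1
      rw [eq_iff_iff]
      omega
    · exact ((listSum_congr (G := fun _ => 0) fun L _ => if_neg (by omega)).trans
        (listSum_zero _ _)).symm
  rw [h1, tsum_wt_mul hp, markedWt, listSum_succ_eq hp, ← ENNReal.tsum_add]
  refine tsum_congr fun d => ?_
  rw [markedWt, ← listSum_append, ← mul_add, ← listSum_add]
  congr 1
  refine listSum_congr fun ts _ => ?_
  rw [← listSum_add]
  refine listSum_congr fun L _ => ?_
  simp only [List.map_cons, List.sum_cons, PTree.size_node, List.map_append, List.sum_append,
    List.flatMap_cons, PTree.subtrees_node, List.flatMap_append, List.cons_append]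
  have : 1 + (ts.map PTree.size).sum + (L.map PTree.size).sum = n + 1 ↔
      (ts.map PTree.size).sum + (L.map PTree.size).sum = n := by omega
  simp only [this]
  split_ifs <;> simp

lemma markedWt_eq (hp : ∀ i, 0 ≤ p i) (g : PTree → ℝ≥0∞) (n m : ℕ) :
    markedWt p g n m = ∑' x, wt p x * (g x * ENNReal.ofReal
      (if x.size ≤ n ∧ m ≤ n - x.size + 1 then
        m * walkCoeff p (n - x.size) (n - x.size + 1 - m) else 0)) := by
  induction n generalizing m with
  | zero =>
    have h0 : ∀ x : PTree, ¬ (x.size ≤ 0 ∧ m ≤ 0 - x.size + 1) := fun x => by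
      have := x.one_le_size
      omega
    simp only [h0, if_false, ENNReal.ofReal_zero, mul_zero, tsum_zero]
    rw [markedWt]
    refine (listSum_congr (G := fun _ => 0) fun L _ => ?_).trans (listSum_zero _ _)
    split_ifs with h
    · have := PTree.length_le_sum_size L
      rw [List.length_eq_zero_iff.1 (by omega : L.length = 0)]
      simp
    · rfl
  | succ n ih =>
    cases m with
    | zero => simp [markedWt, listSum]
    | succ m =>
      rw [markedWt_succ_succ hp]
      simp only [ih, ← ENNReal.tsum_mul_left]
      rw [ENNReal.tsum_comm, ← ENNReal.tsum_add]
      refine tsum_congr fun x => ?_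
      simp only [mul_left_comm (ENNReal.ofReal (p _)), ENNReal.tsum_mul_left]
      rw [← mul_add, ← mul_add]
      congr 2
      rcases Nat.lt_trichotomy x.size (n + 1) with hx | hx | hx
      · obtain ⟨N, hN⟩ : ∃ N, n = x.size + N := ⟨n - x.size, by omega⟩
        rw [if_pos hx.le, show n + 1 - x.size = N + 1 by omega, show n - x.size = N by omega,
          forestWt_eq hp, tsum_ofReal_mul_eq_sum hp (N + 1 - m)]
        · by_cases hm : m ≤ N + 1
          · rw [if_pos hm, if_pos ⟨by omega, by omega⟩]
            have h2 : ∀ d ∈ range (N + 1 - m + 1),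
                p d * (if x.size ≤ n ∧ d + m ≤ N + 1 then ((d + m : ℕ) : ℝ) *
                  walkCoeff p N (N + 1 - (d + m)) else 0) =
                p d * ((d + m) * walkCoeff p N (N + 1 - m - d)) := by
              intro d hd
              rw [mem_range] at hd
              rw [if_pos ⟨by omega, by omega⟩, show N + 1 - (d + m) = N + 1 - m - d by omega]
              push_cast
              ring
            rw [sum_congr rfl h2, sum_add_mul_walkCoeff, Nat.cast_sub hm,
              show N + 1 + 1 - (m + 1) = N + 1 - m by omega, ← ENNReal.ofReal_add]
            · congr 1
              push_cast
              field_simp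
              ring
            · exact mul_nonneg (by positivity) (walkCoeff_nonneg hp _ _)
            · refine mul_nonneg (add_nonneg (by positivity) (div_nonneg ?_ (by positivity)))
                (walkCoeff_nonneg hp _ _)
              rw [sub_nonneg]
              exact_mod_cast hm
          · rw [if_neg hm, if_neg (by omega), ENNReal.ofReal_zero, zero_add,
              ENNReal.ofReal_eq_zero]
            refine (sum_eq_zero fun d _ => ?_).le
            rw [if_neg (by omega), mul_zero]
        · intro d
          split_ifs
          · exact mul_nonneg (by positivity) (walkCoeff_nonneg hp _ _)
          · exact le_rfl
        · intro d hd
          split_ifs with h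
          · rw [show d + m = 0 by omega]; simp
          · rfl
      · have h0 : ∀ d, ¬ (x.size ≤ n ∧ d + m ≤ n - x.size + 1) := fun d => by omega
        simp only [h0, if_false, ENNReal.ofReal_zero, mul_zero, tsum_zero, add_zero]
        rw [if_pos hx.le, show n + 1 - x.size = 0 by omega, forestWt_zero_left]
        rcases m with _ | m
        · simp [hx, walkCoeff_zero]
        · simp
      · have h0 : ∀ d, ¬ (x.size ≤ n ∧ d + m ≤ n - x.size + 1) := fun d => by omega
        have h1 : ¬ (x.size ≤ n + 1 ∧ m + 1 ≤ n + 1 - x.size + 1) := by omega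
        simp only [h0, h1, if_false, ENNReal.ofReal_zero, mul_zero, tsum_zero, add_zero]
        rw [if_neg (by omega)]

lemma tsum_wt_size_eq (hp : ∀ i, 0 ≤ p i) (n : ℕ) :
    ∑' x, (if x.size = n + 1 then wt p x else 0) =
      ENNReal.ofReal (1 / (n + 1) * walkCoeff p (n + 1) n) := by
  have h := forestWt_eq hp n 1
  rw [if_pos (by omega), Nat.add_sub_cancel, Nat.cast_one] at h
  rw [← h, forestWt, listSum]
  exact tsum_congr fun x => by simp [listSum]

lemma tsum_wt_marked (hp : ∀ i, 0 ≤ p i) (g : PTree → ℝ≥0∞) (n : ℕ) :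
    ∑' x, (if x.size = n then wt p x * (x.subtrees.map g).sum else 0) =
      ∑' x, wt p x * (g x * if x.size ≤ n then
        ENNReal.ofReal (walkCoeff p (n - x.size) (n - x.size)) else 0) := by
  have h := markedWt_eq hp g n 1
  rw [markedWt, listSum] at h
  simp only [listSum] at h
  rw [show (∑' x : PTree, if x.size = n then wt p x * (x.subtrees.map g).sum else 0) =
    ∑' x, wt p x * if ([x].map PTree.size).sum = n then
      (([x].flatMap PTree.subtrees).map g).sum else 0 from tsum_congr fun x => by simp, h]
  refine tsum_congr fun x => ?_
  congr 2
  by_cases hx : x.size ≤ n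
  · simp [hx]
  · simp [hx]

end Forests

section GeneratingFunction

variable {p : ℕ → ℝ}

/-- The probability generating function of `p`. -/
noncomputable def pgf (p : ℕ → ℝ) (x : ℝ) : ℝ := ∑' i, p i * x ^ i

/-- The probability that a variable with law `p` is at least two. -/
noncomputable def branchProb (p : ℕ → ℝ) : ℝ := ∑' i, if 2 ≤ i then p i else 0

lemma summable_of_tsum_eq_one {f : ℕ → ℝ} (h : ∑' i, f i = 1) : Summable f := by
  by_contra hf
  rw [tsum_eq_zero_of_not_summable hf] at h
  exact zero_ne_one h

lemma summable_mul_pow (hp : ∀ i, 0 ≤ p i) (hs : Summable p) {x : ℝ} (h0 : 0 ≤ x) (h1 : x ≤ 1) :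
    Summable (fun i => p i * x ^ i) :=
  hs.of_nonneg_of_le (fun i => mul_nonneg (hp i) (by positivity))
    (fun i => mul_le_of_le_one_right (hp i) (pow_le_one₀ h0 h1))

lemma summable_branch (hp : ∀ i, 0 ≤ p i) (hs : Summable p) :
    Summable (fun i => if 2 ≤ i then p i else 0) :=
  hs.of_nonneg_of_le (fun i => by split_ifs; exacts [hp i, le_rfl])
    (fun i => by split_ifs; exacts [le_rfl, hp i])

lemma branchProb_nonneg (hp : ∀ i, 0 ≤ p i) : 0 ≤ branchProb p :=
  tsum_nonneg fun i => by split_ifs; exacts [hp i, le_rfl]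

lemma branchProb_le_one (hp : ∀ i, 0 ≤ p i) (h1 : ∑' i, p i = 1) : branchProb p ≤ 1 := by
  have hs := summable_of_tsum_eq_one h1
  rw [← h1]
  exact (summable_branch hp hs).tsum_le_tsum
    (fun i => by split_ifs; exacts [le_rfl, hp i]) hs

lemma exists_two_le_pos (hp : ∀ i, 0 ≤ p i) (hm : ∑' i : ℕ, (i : ℝ) * p i = 1)
    (hvar : 1 < ∑' i : ℕ, (i : ℝ) ^ 2 * p i) : ∃ i, 2 ≤ i ∧ 0 < p i := by
  by_contra! h
  refine hvar.ne' ?_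
  rw [← hm]
  refine tsum_congr fun i => ?_
  rcases Nat.lt_or_ge i 2 with hi | hi
  · interval_cases i <;> simp
  · rw [le_antisymm (h i hi) (hp i)]; simp

lemma branchProb_pos (hp : ∀ i, 0 ≤ p i) (hs : Summable p)
    (hm : ∑' i : ℕ, (i : ℝ) * p i = 1)
    (hvar : 1 < ∑' i : ℕ, (i : ℝ) ^ 2 * p i) : 0 < branchProb p := by
  obtain ⟨i, hi, hpi⟩ := exists_two_le_pos hp hm hvar
  refine (summable_branch hp hs).tsum_pos (fun i => by split_ifs; exacts [hp i, le_rfl]) i ?_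
  rwa [if_pos hi]

lemma one_sub_pow_ge (q : ℝ) (h0 : 0 ≤ q) (h1 : q ≤ 1) (i : ℕ) :
    1 - i * q + (if 2 ≤ i then q ^ 2 else 0) ≤ (1 - q) ^ i := by
  rcases Nat.lt_or_ge i 2 with hi | hi
  · interval_cases i <;> simp
  · rw [if_pos hi]
    induction i, hi using Nat.le_induction with
    | base => apply le_of_eq; push_cast; ring
    | succ i hi ih =>
      have hpow : (1 - q) ^ i ≤ 1 := pow_le_one₀ (by linarith) (by linarith)
      rw [pow_succ (1 - q)]
      push_cast
      nlinarith [mul_nonneg h0 (sub_nonneg.2 hpow)]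

lemma one_sub_pow_le (q : ℝ) (h0 : 0 ≤ q) (h1 : q ≤ 1) (i : ℕ) :
    (1 - q) ^ i ≤ 1 - i * q + (i : ℝ) ^ 2 * q ^ 2 := by
  induction i with
  | zero => simp
  | succ i ih =>
    have hber := one_add_mul_le_pow (show (-2 : ℝ) ≤ -q by linarith) i
    rw [← sub_eq_add_neg] at hber
    rw [pow_succ]
    push_cast
    nlinarith [mul_nonneg (mul_nonneg h0 h0) (Nat.cast_nonneg (α := ℝ) i)]

lemma pgf_one_sub_ge (hp : ∀ i, 0 ≤ p i) (h1 : ∑' i, p i = 1)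
    (hm : ∑' i : ℕ, (i : ℝ) * p i = 1) {q : ℝ} (hq0 : 0 ≤ q) (hq1 : q ≤ 1) :
    1 - q + branchProb p * q ^ 2 ≤ pgf p (1 - q) := by
  have hs := summable_of_tsum_eq_one h1
  have hsm := summable_of_tsum_eq_one hm
  have hb := summable_branch hp hs
  have e : 1 - q + branchProb p * q ^ 2 =
      ∑' i, (p i - q * (i * p i) + q ^ 2 * (if 2 ≤ i then p i else 0)) := by
    rw [((hs.sub (hsm.mul_left q))).tsum_add (hb.mul_left _), hs.tsum_sub (hsm.mul_left q),
      tsum_mul_left, tsum_mul_left, h1, hm, branchProb]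
    ring
  rw [e]
  refine ((hs.sub (hsm.mul_left q)).add (hb.mul_left _)).tsum_le_tsum (fun i => ?_)
    (summable_mul_pow hp hs (by linarith) (by linarith))
  have := mul_le_mul_of_nonneg_left (one_sub_pow_ge q hq0 hq1 i) (hp i)
  split_ifs at this ⊢ <;> linarith

lemma pgf_one_sub_le (hp : ∀ i, 0 ≤ p i) (h1 : ∑' i, p i = 1)
    (hm : ∑' i : ℕ, (i : ℝ) * p i = 1) (h2 : Summable (fun i : ℕ => (i : ℝ) ^ 2 * p i))
    {q : ℝ} (hq0 : 0 ≤ q) (hq1 : q ≤ 1) :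
    pgf p (1 - q) ≤ 1 - q + (∑' i : ℕ, (i : ℝ) ^ 2 * p i) * q ^ 2 := by
  have hs := summable_of_tsum_eq_one h1
  have hsm := summable_of_tsum_eq_one hm
  have e : 1 - q + (∑' i : ℕ, (i : ℝ) ^ 2 * p i) * q ^ 2 =
      ∑' i : ℕ, (p i - q * (i * p i) + q ^ 2 * ((i : ℝ) ^ 2 * p i)) := by
    rw [((hs.sub (hsm.mul_left q))).tsum_add (h2.mul_left _), hs.tsum_sub (hsm.mul_left q),
      tsum_mul_left, tsum_mul_left, h1, hm]
    ring
  rw [e]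
  refine (summable_mul_pow hp hs (by linarith) (by linarith)).tsum_le_tsum (fun i => ?_)
    ((hs.sub (hsm.mul_left q)).add (h2.mul_left _))
  have := mul_le_mul_of_nonneg_left (one_sub_pow_le q hq0 hq1 i) (hp i)
  linarith

lemma tsum_mul_pow_pred_le (hp : ∀ i, 0 ≤ p i) (h1 : ∑' i, p i = 1)
    (hm : ∑' i : ℕ, (i : ℝ) * p i = 1) {q : ℝ} (hq0 : 0 ≤ q) (hq1 : q ≤ 1) :
    Summable (fun i : ℕ => p i * (i * (1 - q) ^ (i - 1))) ∧
    ∑' i : ℕ, p i * (i * (1 - q) ^ (i - 1)) ≤ 1 - branchProb p * q := by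
  have hs := summable_of_tsum_eq_one h1
  have hsm := summable_of_tsum_eq_one hm
  have hb := summable_branch hp hs
  have hle : ∀ i : ℕ, (1 - q) ^ (i - 1) ≤ 1 := fun i => pow_le_one₀ (by linarith) (by linarith)
  have hsum : Summable (fun i : ℕ => p i * (i * (1 - q) ^ (i - 1))) := by
    refine hsm.of_nonneg_of_le (fun i => ?_) (fun i => ?_)
    · exact mul_nonneg (hp i) (mul_nonneg (by positivity) (pow_nonneg (by linarith) _))
    · have := mul_le_mul_of_nonneg_left (hle i) (mul_nonneg (hp i) (Nat.cast_nonneg (α := ℝ) i))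
      linarith
  refine ⟨hsum, ?_⟩
  have e : 1 - branchProb p * q =
      ∑' i : ℕ, (i * p i - q * (if 2 ≤ i then p i else 0)) := by
    rw [hsm.tsum_sub (hb.mul_left q), tsum_mul_left, hm, branchProb]
    ring
  rw [e]
  refine hsum.tsum_le_tsum (fun i => ?_) (hsm.sub (hb.mul_left _))
  split_ifs with hi
  · have h3 : (1 - q) ^ (i - 1) ≤ 1 - q := by
      obtain ⟨j, rfl⟩ : ∃ j, i = j + 2 := ⟨i - 2, by omega⟩
      rw [show j + 2 - 1 = j + 1 by omega, pow_succ]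
      exact mul_le_of_le_one_left (by linarith) (pow_le_one₀ (by linarith) (by linarith))
    have hi' : (1 : ℝ) ≤ i := by exact_mod_cast (by omega : 1 ≤ i)
    have h4 := mul_le_mul_of_nonneg_left h3 (mul_nonneg (hp i) (Nat.cast_nonneg (α := ℝ) i))
    have h5 : q * p i * 1 ≤ q * p i * i :=
      mul_le_mul_of_nonneg_left hi' (mul_nonneg hq0 (hp i))
    linarith
  · have := mul_le_mul_of_nonneg_left (hle i) (mul_nonneg (hp i) (Nat.cast_nonneg (α := ℝ) i))
    linarith

lemma tsum_ofReal_mul_pow (hp : ∀ i, 0 ≤ p i) (hs : Summable p) {x : ℝ}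
    (h0 : 0 ≤ x) (h1 : x ≤ 1) :
    ∑' d, ENNReal.ofReal (p d) * ENNReal.ofReal x ^ d = ENNReal.ofReal (pgf p x) := by
  rw [pgf, ENNReal.ofReal_tsum_of_nonneg (fun i => mul_nonneg (hp i) (by positivity))
    (summable_mul_pow hp hs h0 h1)]
  refine tsum_congr fun d => ?_
  rw [ENNReal.ofReal_mul (hp d), ENNReal.ofReal_pow h0]

lemma pgf_nonneg (hp : ∀ i, 0 ≤ p i) {x : ℝ} (h0 : 0 ≤ x) : 0 ≤ pgf p x :=
  tsum_nonneg fun i => mul_nonneg (hp i) (by positivity)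

lemma pgf_le_one (hp : ∀ i, 0 ≤ p i) (h1 : ∑' i, p i = 1) {x : ℝ} (h0 : 0 ≤ x) (hx : x ≤ 1) :
    pgf p x ≤ 1 := by
  have hs := summable_of_tsum_eq_one h1
  rw [← h1]
  exact (summable_mul_pow hp hs h0 hx).tsum_le_tsum
    (fun i => mul_le_of_le_one_right (hp i) (pow_le_one₀ h0 hx)) hs

end GeneratingFunction

section Height

variable {p : ℕ → ℝ}

lemma prod_ite_forall {α : Type*} (L : List α) (Q : α → Prop) [DecidablePred Q]
    (R : Prop) [Decidable R] (hR : R ↔ ∀ x ∈ L, Q x) :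
    (if R then (1 : ℝ≥0∞) else 0) = (L.map fun x => if Q x then 1 else 0).prod := by
  simp only [hR]
  clear hR
  induction L with
  | nil => simp
  | cons x L ih =>
    simp only [List.map_cons, List.prod_cons, ← ih, List.forall_mem_cons]
    by_cases h : Q x <;> simp [h]

lemma tsum_wt_height_lt (hp : ∀ i, 0 ≤ p i) (s : ℕ) :
    ∑' x, wt p x * (if x.height < s + 1 then 1 else 0) =
      ∑' d, ENNReal.ofReal (p d) * (∑' x, wt p x * (if x.height < s then 1 else 0)) ^ d := by
  rw [tsum_wt_mul hp]
  refine tsum_congr fun d => ?_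
  rw [← listSum_prod]
  congr 1
  refine listSum_congr fun L _ => ?_
  refine prod_ite_forall L (fun x => x.height < s) _ ?_
  rw [← not_le, PTree.le_height_node]
  push Not
  rfl

/-- The probability that the height of a Galton-Watson tree is less than `s`. -/
noncomputable def heightLt (p : ℕ → ℝ) : ℕ → ℝ
  | 0 => 0
  | s + 1 => pgf p (heightLt p s)

lemma heightLt_mem (hp : ∀ i, 0 ≤ p i) (h1 : ∑' i, p i = 1) (s : ℕ) :
    0 ≤ heightLt p s ∧ heightLt p s ≤ 1 := by
  induction s with
  | zero => simp [heightLt]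
  | succ s ih => exact ⟨pgf_nonneg hp ih.1, pgf_le_one hp h1 ih.1 ih.2⟩

lemma tsum_wt_height_lt_eq (hp : ∀ i, 0 ≤ p i) (h1 : ∑' i, p i = 1) (s : ℕ) :
    ∑' x, wt p x * (if x.height < s then 1 else 0) = ENNReal.ofReal (heightLt p s) := by
  induction s with
  | zero => simp [heightLt]
  | succ s ih =>
    have h := heightLt_mem hp h1 s
    rw [tsum_wt_height_lt hp, ih, tsum_ofReal_mul_pow hp (summable_of_tsum_eq_one h1) h.1 h.2,
      heightLt]

lemma tsum_wt_le_one (hp : ∀ i, 0 ≤ p i) (h1 : ∑' i, p i = 1) : ∑' x, wt p x ≤ 1 := by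
  rw [ENNReal.tsum_eq_iSup_sum]
  refine iSup_le fun A => ?_
  calc ∑ x ∈ A, wt p x
      = ∑ x ∈ A, wt p x * (if x.height < A.sup PTree.height + 1 then 1 else 0) := by
        refine sum_congr rfl fun x hx => ?_
        rw [if_pos (Nat.lt_succ_of_le (le_sup hx)), mul_one]
    _ ≤ ∑' x, wt p x * (if x.height < A.sup PTree.height + 1 then 1 else 0) :=
        ENNReal.sum_le_tsum _
    _ ≤ 1 := by
        rw [tsum_wt_height_lt_eq hp h1]
        exact ENNReal.ofReal_le_one.2 (heightLt_mem hp h1 _).2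

lemma one_sub_heightLt_le (hp : ∀ i, 0 ≤ p i) (h1 : ∑' i, p i = 1)
    (hm : ∑' i : ℕ, (i : ℝ) * p i = 1) (s : ℕ) :
    (1 + branchProb p * s) * (1 - heightLt p s) ≤ 1 := by
  induction s with
  | zero => simp [heightLt]
  | succ s ih =>
    have h := heightLt_mem hp h1 s
    set q := 1 - heightLt p s with hq
    have h2 := pgf_one_sub_ge hp h1 hm (q := q) (by linarith) (by linarith)
    rw [show 1 - q = heightLt p s by rw [hq]; ring] at h2
    have hb0 := branchProb_nonneg hp
    have hb1 := branchProb_le_one hp h1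
    set b := branchProb p
    rw [heightLt]
    have hq0 : 0 ≤ q := by linarith
    have hbq : b * q ≤ 1 := by nlinarith
    have hs0 : (0 : ℝ) ≤ s := Nat.cast_nonneg s
    have h3 : 1 - pgf p (heightLt p s) ≤ q * (1 - b * q) := by nlinarith
    push_cast
    calc (1 + b * (s + 1)) * (1 - pgf p (heightLt p s))
        ≤ (1 + b * (s + 1)) * (q * (1 - b * q)) :=
          mul_le_mul_of_nonneg_left h3 (by positivity)
      _ = ((1 + b * s) * q) * (1 - b * q) + b * q * (1 - b * q) := by ring
      _ ≤ 1 * (1 - b * q) + b * q * (1 - b * q) := by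
          gcongr
      _ ≤ 1 := by nlinarith [sq_nonneg (b * q)]

/-- Kolmogorov's upper bound for the tail of the height. -/
lemma tsum_wt_le_height_le (hp : ∀ i, 0 ≤ p i) (h1 : ∑' i, p i = 1)
    (hm : ∑' i : ℕ, (i : ℝ) * p i = 1) (hb : 0 < branchProb p) {s : ℕ} (hs : 1 ≤ s) :
    ∑' x, wt p x * (if s ≤ x.height then 1 else 0) ≤
      ENNReal.ofReal ((branchProb p)⁻¹ / s) := by
  have h := heightLt_mem hp h1 s
  have htot : ∑' x, wt p x * (if s ≤ x.height then 1 else 0) +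
      ENNReal.ofReal (heightLt p s) ≤ 1 := by
    rw [← tsum_wt_height_lt_eq hp h1, ← ENNReal.tsum_add]
    refine le_trans (ENNReal.tsum_le_tsum fun x => ?_) (tsum_wt_le_one hp h1)
    rcases Nat.lt_or_ge x.height s with hx | hx
    · simp [hx, hx.not_ge]
    · simp [hx, hx.not_gt]
  calc _ ≤ 1 - ENNReal.ofReal (heightLt p s) := ENNReal.le_sub_of_add_le_right (by simp) htot
    _ = ENNReal.ofReal (1 - heightLt p s) := by
        rw [ENNReal.ofReal_sub _ h.1, ENNReal.ofReal_one]
    _ ≤ _ := by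
        refine ENNReal.ofReal_le_ofReal ?_
        have h2 := one_sub_heightLt_le hp h1 hm s
        have hs' : (0 : ℝ) < s := by exact_mod_cast hs
        rw [le_div_iff₀ hs', ← one_div, le_div_iff₀ hb]
        nlinarith

/-- The generating function of trees by size. -/
noncomputable def treeGf (p : ℕ → ℝ) (r : ℝ≥0∞) : ℝ≥0∞ := ∑' x, wt p x * r ^ x.size

lemma prod_map_pow_size (r : ℝ≥0∞) (L : List PTree) :
    (L.map fun x => r ^ x.size).prod = r ^ (L.map PTree.size).sum := by
  induction L with
  | nil => simp
  | cons x L ih => simp [ih, pow_add]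

lemma treeGf_eq (hp : ∀ i, 0 ≤ p i) (r : ℝ≥0∞) :
    treeGf p r = r * ∑' d, ENNReal.ofReal (p d) * treeGf p r ^ d := by
  conv_lhs => rw [treeGf, tsum_wt_mul hp]
  rw [← ENNReal.tsum_mul_left]
  refine tsum_congr fun d => ?_
  rw [treeGf, ← listSum_prod, mul_left_comm]
  congr 1
  rw [← listSum_mul_left]
  refine listSum_congr fun L _ => ?_
  rw [PTree.size_node, prod_map_pow_size, pow_add, pow_one]

/-- The generating function of trees of height at least `s` by size. -/
noncomputable def heightGf (p : ℕ → ℝ) (r : ℝ≥0∞) (s : ℕ) : ℝ≥0∞ :=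
  ∑' x, wt p x * ((if s ≤ x.height then 1 else 0) * r ^ x.size)

lemma heightGf_succ_le (hp : ∀ i, 0 ≤ p i) (r : ℝ≥0∞) (s : ℕ) :
    heightGf p r (s + 1) ≤
      (r * ∑' d : ℕ, ENNReal.ofReal (p d) * (d * treeGf p r ^ (d - 1))) * heightGf p r s := by
  rw [heightGf, tsum_wt_mul hp, mul_comm r, mul_assoc, ← ENNReal.tsum_mul_right]
  refine ENNReal.tsum_le_tsum fun d => ?_
  rw [mul_assoc]
  refine mul_le_mul_right ?_ _
  rcases d with _ | d
  · have h0 : ¬ s + 1 ≤ (PTree.node []).height := by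
      rw [PTree.le_height_node]
      simp
    simp only [listSum, if_neg h0, zero_mul, zero_le]
  · let F : PTree × List PTree → ℝ≥0∞ := fun q =>
      r * ((if s ≤ q.1.height then 1 else 0) * r ^ q.1.size * (q.2.map fun x => r ^ x.size).prod)
    calc listSum (wt p) (d + 1) _ ≤ listSum (wt p) (d + 1) (fun L => ((picks L).map F).sum) := by
          refine listSum_mono fun L _ => ?_
          split_ifs with h
          · obtain ⟨x, hx, hxs⟩ := (PTree.le_height_node L s).1 h
            obtain ⟨L', hL'⟩ := exists_mem_picks hx
            refine le_trans (le_of_eq ?_)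
              (List.single_le_sum (fun _ _ => zero_le) _ (List.mem_map_of_mem hL'))
            have hsum := ((perm_of_mem_picks hL').map PTree.size).sum_eq
            rw [List.map_cons, List.sum_cons] at hsum
            simp only [F, if_pos hxs, one_mul, PTree.size_node, prod_map_pow_size, ← hsum, pow_add,
              pow_one]
          · simp
      _ = _ := by
          have key : ∀ x, listSum (wt p) d (fun L => F (x, L)) =
              r * ((if s ≤ x.height then 1 else 0) * r ^ x.size * treeGf p r ^ d) := by
            intro x
            rw [treeGf, ← listSum_prod (wt p), ← listSum_mul_left, ← listSum_mul_left]
          have e : ∀ x, wt p x * (r * ((if s ≤ x.height then 1 else 0) * r ^ x.size *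
              treeGf p r ^ d)) =
              r * treeGf p r ^ d * (wt p x * ((if s ≤ x.height then 1 else 0) * r ^ x.size)) := by
            intro x
            ring
          rw [listSum_picks]
          simp only [key, e, ENNReal.tsum_mul_left, Nat.add_sub_cancel]
          rw [← heightGf]
          push_cast
          ring

lemma heightGf_add_le (hp : ∀ i, 0 ≤ p i) (r : ℝ≥0∞) (s j : ℕ) :
    heightGf p r (s + j) ≤
      (r * ∑' d : ℕ, ENNReal.ofReal (p d) * (d * treeGf p r ^ (d - 1))) ^ j * heightGf p r s := by
  induction j with
  | zero => simp
  | succ j ih =>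
    rw [← add_assoc, pow_succ', mul_assoc]
    exact (heightGf_succ_le hp r _).trans (mul_le_mul_right ih _)

lemma deriv_factor_le (hp : ∀ i, 0 ≤ p i) (h1 : ∑' i, p i = 1)
    (hm : ∑' i : ℕ, (i : ℝ) * p i = 1) (h2 : Summable (fun i : ℕ => (i : ℝ) ^ 2 * p i))
    {ε : ℝ} (h0 : 0 < ε) (hε : ε ≤ 1 / 2) :
    ENNReal.ofReal (1 - ε) * ∑' d : ℕ, ENNReal.ofReal (p d) *
        (d * treeGf p (ENNReal.ofReal (1 - ε)) ^ (d - 1)) ≤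
      ENNReal.ofReal (Real.exp (-(branchProb p *
        Real.sqrt (ε / (2 * (∑' i : ℕ, (i : ℝ) ^ 2 * p i) + 2))))) := by
  have hs := summable_of_tsum_eq_one h1
  set r := ENNReal.ofReal (1 - ε) with hr
  set M := ∑' i : ℕ, (i : ℝ) ^ 2 * p i with hM
  have hM0 : 0 ≤ M := tsum_nonneg fun i => mul_nonneg (by positivity) (hp i)
  have hr1 : r ≤ 1 := ENNReal.ofReal_le_one.2 (by linarith)
  have hT1 : treeGf p r ≤ 1 := by
    refine le_trans (ENNReal.tsum_le_tsum fun x => ?_) (tsum_wt_le_one hp h1)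
    exact mul_le_of_le_one_right zero_le (pow_le_one₀ zero_le hr1)
  obtain ⟨y, hy0, hy⟩ : ∃ y : ℝ, 0 ≤ y ∧ treeGf p r = ENNReal.ofReal y :=
    ⟨_, ENNReal.toReal_nonneg, (ENNReal.ofReal_toReal (ne_top_of_le_ne_top (by simp) hT1)).symm⟩
  have hy1 : y ≤ 1 := by rwa [hy, ENNReal.ofReal_le_one] at hT1
  have hfix : y = (1 - ε) * pgf p y := by
    have h := treeGf_eq hp r
    rw [hy, tsum_ofReal_mul_pow hp hs hy0 hy1, hr, ← ENNReal.ofReal_mul (by linarith)] at h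
    exact (ENNReal.ofReal_eq_ofReal_iff hy0
      (mul_nonneg (by linarith) (pgf_nonneg hp hy0))).1 h
  obtain ⟨q, hq⟩ : ∃ q, q = 1 - y := ⟨_, rfl⟩
  have hq0 : 0 ≤ q := by linarith
  have hq1 : q ≤ 1 := by linarith
  have hyq : y = 1 - q := by linarith
  have hup := pgf_one_sub_le hp h1 hm h2 hq0 hq1
  rw [hyq] at hfix
  have hqε : ε ≤ (2 * M + 2) * q ^ 2 := by
    rw [← hM] at hup
    have h4 : ε * (1 - q) ≤ M * q ^ 2 := by
      have h5 : 1 - q ≤ (1 - ε) * (1 - q + M * q ^ 2) := by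
        calc 1 - q = (1 - ε) * pgf p (1 - q) := hfix
          _ ≤ _ := mul_le_mul_of_nonneg_left hup (by linarith)
      have h6 : 0 ≤ ε * (M * q ^ 2) := by positivity
      nlinarith
    have h7 : 0 ≤ M * q ^ 2 := by positivity
    rcases le_total q (1 / 2) with hh | hh
    · nlinarith
    · nlinarith
  have hqs : Real.sqrt (ε / (2 * M + 2)) ≤ q := by
    refine Real.sqrt_le_iff.2 ⟨hq0, ?_⟩
    rw [div_le_iff₀ (by positivity)]
    linarith
  obtain ⟨hsum, hder⟩ := tsum_mul_pow_pred_le hp h1 hm hq0 hq1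
  rw [hy, hyq]
  have e : ∑' d : ℕ, ENNReal.ofReal (p d) * (d * ENNReal.ofReal (1 - q) ^ (d - 1)) =
      ENNReal.ofReal (∑' d : ℕ, p d * (d * (1 - q) ^ (d - 1))) := by
    have hq' : 0 ≤ 1 - q := by linarith
    rw [ENNReal.ofReal_tsum_of_nonneg (fun i => mul_nonneg (hp i) (by positivity)) hsum]
    refine tsum_congr fun d => ?_
    rw [ENNReal.ofReal_mul (hp d), ENNReal.ofReal_mul (by positivity), ENNReal.ofReal_pow hq',
      ENNReal.ofReal_natCast]
  rw [e]
  refine (mul_le_of_le_one_left zero_le hr1).trans (ENNReal.ofReal_le_ofReal (hder.trans ?_))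
  have hbq := mul_le_mul_of_nonneg_left hqs (branchProb_nonneg hp)
  refine le_trans ?_ (Real.exp_le_exp.2 (neg_le_neg hbq) |>.trans' (le_refl _))
  have := Real.add_one_le_exp (-(branchProb p * q))
  linarith

end Height

/-- A critical offspring law with finite positive variance. -/
structure IsCriticalLaw (p : ℕ → ℝ) : Prop where
  nonneg : ∀ i, 0 ≤ p i
  tsum_eq : ∑' i, p i = 1
  mean_eq : ∑' i : ℕ, (i : ℝ) * p i = 1
  summable_sq : Summable (fun i : ℕ => (i : ℝ) ^ 2 * p i)
  one_lt_sq : 1 < ∑' i : ℕ, (i : ℝ) ^ 2 * p i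

namespace IsCriticalLaw

variable {p : ℕ → ℝ}

lemma summable (h : IsCriticalLaw p) : Summable p := summable_of_tsum_eq_one h.tsum_eq

lemma summable_mean (h : IsCriticalLaw p) : Summable (fun i : ℕ => (i : ℝ) * p i) :=
  summable_of_tsum_eq_one h.mean_eq

lemma branchProb_pos (h : IsCriticalLaw p) : 0 < branchProb p :=
  _root_.branchProb_pos h.nonneg h.summable h.mean_eq h.one_lt_sq

lemma tsum_wt_le_one (h : IsCriticalLaw p) : ∑' x, wt p x ≤ 1 :=
  _root_.tsum_wt_le_one h.nonneg h.tsum_eq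

lemma heightGf_le (h : IsCriticalLaw p) {ε : ℝ} (h0 : 0 < ε) (hε : ε ≤ 1 / 2) {s : ℕ}
    (hs : 1 ≤ s) :
    heightGf p (ENNReal.ofReal (1 - ε)) (s + s) ≤ ENNReal.ofReal
      (Real.exp (-(s * (branchProb p *
        Real.sqrt (ε / (2 * (∑' i : ℕ, (i : ℝ) ^ 2 * p i) + 2))))) * ((branchProb p)⁻¹ / s)) := by
  refine (heightGf_add_le h.nonneg _ s s).trans ?_
  rw [ENNReal.ofReal_mul (Real.exp_nonneg _)]
  refine mul_le_mul' ?_ ?_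
  · refine (pow_le_pow_left' (deriv_factor_le h.nonneg h.tsum_eq h.mean_eq h.summable_sq h0 hε)
      s).trans (le_of_eq ?_)
    rw [← ENNReal.ofReal_pow (Real.exp_nonneg _), ← Real.exp_nat_mul, mul_neg]
  · refine le_trans (ENNReal.tsum_le_tsum fun x => ?_)
      (tsum_wt_le_height_le h.nonneg h.tsum_eq h.mean_eq h.branchProb_pos hs)
    gcongr
    exact mul_le_of_le_one_right zero_le
      (pow_le_one₀ zero_le (ENNReal.ofReal_le_one.2 (by linarith)))

lemma exists_small_tall_le (h : IsCriticalLaw p) : ∃ κ : ℝ, 0 < κ ∧ ∀ s : ℕ, 1 ≤ s → ∀ i : ℕ,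
    ∑' x, wt p x * (if 2 * s ≤ x.height ∧ 4 ^ i * x.size ≤ s ^ 2 then 1 else 0) ≤
      ENNReal.ofReal (2 * Real.exp (-(κ * 2 ^ i)) * ((branchProb p)⁻¹ / s)) := by
  set M := ∑' i : ℕ, (i : ℝ) ^ 2 * p i with hM
  have hM1 : 1 < M := h.one_lt_sq
  have hb := h.branchProb_pos
  refine ⟨branchProb p * Real.sqrt (1 / (2 * (2 * M + 2))), by positivity, fun s hs i => ?_⟩
  have hs0 : (0 : ℝ) < s := by exact_mod_cast hs
  by_cases hi : 4 ^ i ≤ s ^ 2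
  swap
  · refine le_trans (le_of_eq ?_) zero_le
    refine ENNReal.tsum_eq_zero.2 fun x => ?_
    rw [if_neg, mul_zero]
    rintro ⟨-, hx⟩
    exact hi ((Nat.le_mul_of_pos_right _ x.one_le_size).trans hx)
  have hi' : (4 : ℝ) ^ i ≤ (s : ℝ) ^ 2 := by exact_mod_cast hi
  set ε : ℝ := 4 ^ i / (2 * s ^ 2) with hε
  have hε0 : 0 < ε := by positivity
  have hε1 : ε ≤ 1 / 2 := by
    rw [hε, div_le_iff₀ (by positivity)]
    linarith
  have key := h.heightGf_le hε0 hε1 hs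
  have hsq : (s : ℝ) * Real.sqrt (ε / (2 * M + 2)) =
      Real.sqrt (1 / (2 * (2 * M + 2))) * 2 ^ i := by
    have e : ε / (2 * M + 2) = (2 ^ i / s) ^ 2 * (1 / (2 * (2 * M + 2))) := by
      rw [hε, div_pow, ← pow_mul, mul_comm i 2, pow_mul]
      norm_num
      field_simp
    rw [e, Real.sqrt_mul (by positivity), Real.sqrt_sq (by positivity)]
    field_simp
  rw [← hM, mul_left_comm, hsq, ← mul_assoc] at key
  calc _ ≤ 2 * heightGf p (ENNReal.ofReal (1 - ε)) (s + s) := by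
        rw [heightGf, ← ENNReal.tsum_mul_left]
        refine ENNReal.tsum_le_tsum fun x => ?_
        rw [mul_left_comm]
        gcongr
        split_ifs with h1 h2 h2
        · rw [one_mul, ← ENNReal.ofReal_pow (by linarith)]
          rw [show (2 : ℝ≥0∞) = ENNReal.ofReal 2 by simp, ← ENNReal.ofReal_mul (by norm_num)]
          rw [ENNReal.one_le_ofReal]
          have hx : (4 : ℝ) ^ i * x.size ≤ (s : ℝ) ^ 2 := by exact_mod_cast h1.2
          have hx2 : x.size * ε ≤ 1 / 2 := by
            rw [hε, mul_div_assoc', div_le_iff₀ (by positivity)]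
            linarith
          have := one_add_mul_le_pow (show (-2 : ℝ) ≤ -ε by linarith) x.size
          rw [← sub_eq_add_neg] at this
          linarith
        · omega
        · exact zero_le
        · exact zero_le
    _ ≤ 2 * _ := mul_le_mul_right key _
    _ = _ := by
        rw [mul_assoc 2, ENNReal.ofReal_mul (p := 2) (by norm_num)]
        simp

lemma inv_sqrt_pow_le (b s N : ℕ) (hs : 1 ≤ s) (hN : 1 ≤ N) :
    ENNReal.ofReal (1 / √N) ^ b ≤ ENNReal.ofReal ((1 / s) ^ b) *
      (1 + ∑' i : ℕ, ENNReal.ofReal ((2 ^ (i + 1)) ^ b) * if 4 ^ i * N ≤ s ^ 2 then 1 else 0) := by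
  have hs0 : (0 : ℝ) < s := by exact_mod_cast hs
  have hN0 : (0 : ℝ) < N := by exact_mod_cast hN
  rw [← ENNReal.ofReal_pow (by positivity)]
  rcases Nat.lt_or_ge (s ^ 2) N with hlt | hle
  · refine le_trans (ENNReal.ofReal_le_ofReal ?_) (le_mul_of_one_le_right zero_le le_self_add)
    gcongr
    exact Real.le_sqrt_of_sq_le (by exact_mod_cast hlt.le)
  · obtain ⟨i, hi1, hi2⟩ : ∃ i, 4 ^ i * N ≤ s ^ 2 ∧ s ^ 2 < 4 ^ (i + 1) * N := by
      have hex : ∃ j, s ^ 2 < 4 ^ j * N := ⟨s ^ 2, (Nat.lt_pow_self (by norm_num)).trans_le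
        (Nat.le_mul_of_pos_right _ hN)⟩
      have hspec := Nat.find_spec hex
      have hmin := fun m => Nat.find_min hex (m := m)
      rcases hj : Nat.find hex with _ | j
      · rw [hj] at hspec
        simp only [pow_zero, one_mul] at hspec
        omega
      · rw [hj] at hspec hmin
        exact ⟨j, not_lt.1 (hmin j (by omega)), hspec⟩
    calc ENNReal.ofReal ((1 / √N) ^ b)
        ≤ ENNReal.ofReal ((1 / s) ^ b * (2 ^ (i + 1)) ^ b) := by
          refine ENNReal.ofReal_le_ofReal ?_
          rw [← mul_pow]
          gcongr
          rw [div_mul_eq_mul_div, one_mul, div_le_div_iff₀ (by positivity) hs0, one_mul]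
          refine le_of_sq_le_sq ?_ (by positivity)
          rw [mul_pow, Real.sq_sqrt hN0.le, ← pow_mul, mul_comm (i + 1) 2, pow_mul]
          norm_num
          exact_mod_cast hi2.le
      _ = ENNReal.ofReal ((1 / s) ^ b) * (ENNReal.ofReal ((2 ^ (i + 1)) ^ b) *
          if 4 ^ i * N ≤ s ^ 2 then 1 else 0) := by
          rw [if_pos hi1, mul_one, ENNReal.ofReal_mul (by positivity)]
      _ ≤ _ := by
          gcongr
          exact (ENNReal.le_tsum i).trans le_add_self

lemma tsum_dyadic_ne_top {κ : ℝ} (hκ : 0 < κ) (b : ℕ) :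
    ∑' i : ℕ, ENNReal.ofReal ((2 ^ (i + 1)) ^ b * (2 * Real.exp (-(κ * 2 ^ i)))) ≠ ⊤ := by
  rw [← ENNReal.ofReal_tsum_of_nonneg (fun i => by positivity)]
  · exact ENNReal.ofReal_ne_top
  have hg : Summable (fun i : ℕ => (2 * 2 ^ b * ((b + 1).factorial / κ ^ (b + 1)) : ℝ) *
      (1 / 2) ^ i) := (summable_geometric_of_lt_one (by norm_num) (by norm_num)).mul_left _
  refine hg.of_nonneg_of_le (fun i => by positivity) fun i => ?_
  have h1 := Real.pow_div_factorial_le_exp (κ * 2 ^ i) (by positivity) (b + 1)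
  have h2 : Real.exp (-(κ * 2 ^ i)) ≤ (b + 1).factorial / (κ * 2 ^ i) ^ (b + 1) := by
    rw [Real.exp_neg, ← inv_div]
    exact inv_anti₀ (by positivity) h1
  calc _ ≤ ((2 : ℝ) ^ (i + 1)) ^ b * (2 * ((b + 1).factorial / (κ * 2 ^ i) ^ (b + 1))) := by
        gcongr
    _ = _ := by
        rw [one_div, inv_pow]
        field_simp
        ring

lemma exists_tall_weighted_le_aux (h : IsCriticalLaw p) (b : ℕ) :
    ∃ K : ℝ, 0 < K ∧ ∀ s : ℕ, 1 ≤ s →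
      ∑' x, wt p x * ((if 2 * s ≤ x.height then 1 else 0) * ENNReal.ofReal (1 / √x.size) ^ b) ≤
        ENNReal.ofReal (K / s ^ (b + 1)) := by
  obtain ⟨κ, hκ, hsmall⟩ := h.exists_small_tall_le
  have hb := h.branchProb_pos
  set A := ∑' i : ℕ, ENNReal.ofReal ((2 ^ (i + 1)) ^ b * (2 * Real.exp (-(κ * 2 ^ i)))) with hA
  have hA' : A ≠ ⊤ := tsum_dyadic_ne_top hκ b
  refine ⟨(branchProb p)⁻¹ * (1 + A.toReal), by positivity, fun s hs => ?_⟩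
  have hs0 : (0 : ℝ) < s := by exact_mod_cast hs
  calc _ ≤ ∑' x, ENNReal.ofReal ((1 / s) ^ b) *
        (wt p x * (if s ≤ x.height then 1 else 0) + ∑' i : ℕ, ENNReal.ofReal ((2 ^ (i + 1)) ^ b) *
          (wt p x * if 2 * s ≤ x.height ∧ 4 ^ i * x.size ≤ s ^ 2 then 1 else 0)) := by
        refine ENNReal.tsum_le_tsum fun x => ?_
        split_ifs with h1 h2 h2
        · rw [one_mul]
          refine (mul_le_mul_right (inv_sqrt_pow_le b s x.size hs x.one_le_size) _).trans
            (le_of_eq ?_)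
          simp only [h1, true_and, mul_one]
          rw [mul_left_comm, mul_add, mul_one, ← ENNReal.tsum_mul_left]
          simp only [mul_left_comm (wt p x)]
        · omega
        all_goals simp
    _ ≤ ENNReal.ofReal ((1 / s) ^ b) * (ENNReal.ofReal ((branchProb p)⁻¹ / s) +
          ∑' i : ℕ, ENNReal.ofReal ((2 ^ (i + 1)) ^ b) *
            ENNReal.ofReal (2 * Real.exp (-(κ * 2 ^ i)) * ((branchProb p)⁻¹ / s))) := by
        rw [ENNReal.tsum_mul_left, ENNReal.tsum_add, ENNReal.tsum_comm]
        gcongr with i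
        · exact tsum_wt_le_height_le h.nonneg h.tsum_eq h.mean_eq hb hs
        · rw [ENNReal.tsum_mul_left]
          gcongr
          exact hsmall s hs i
    _ = ENNReal.ofReal ((1 / s) ^ b) * (ENNReal.ofReal ((branchProb p)⁻¹ / s) * (1 + A)) := by
        congr 1
        rw [mul_add, mul_one, hA, ← ENNReal.tsum_mul_left]
        congr 1
        refine tsum_congr fun i => ?_
        rw [← ENNReal.ofReal_mul (by positivity), ← ENNReal.ofReal_mul (by positivity)]
        congr 1
        ring
    _ = _ := by
        rw [← ENNReal.ofReal_toReal hA', ← ENNReal.ofReal_one,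
          ← ENNReal.ofReal_add zero_le_one ENNReal.toReal_nonneg,
          ← ENNReal.ofReal_mul (by positivity), ← ENNReal.ofReal_mul (by positivity),
          ENNReal.toReal_ofReal ENNReal.toReal_nonneg]
        congr 1
        rw [one_div, inv_pow]
        field_simp
        ring

lemma exists_tall_weighted_le (h : IsCriticalLaw p) (b : ℕ) :
    ∃ K : ℝ, 0 < K ∧ ∀ τ : ℕ, 1 ≤ τ →
      ∑' x, wt p x * ((if τ ≤ x.height then 1 else 0) * ENNReal.ofReal (1 / √x.size) ^ b) ≤
        ENNReal.ofReal (K / τ ^ (b + 1)) := by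
  obtain ⟨K, hK, hle⟩ := h.exists_tall_weighted_le_aux b
  refine ⟨K * 3 ^ (b + 1) + 1, by positivity, fun τ hτ => ?_⟩
  have hτ0 : (0 : ℝ) < τ := by exact_mod_cast hτ
  rcases hτ.eq_or_lt with rfl | hτ2
  · refine le_trans (le_trans (ENNReal.tsum_le_tsum fun x => ?_) h.tsum_wt_le_one) ?_
    · refine mul_le_of_le_one_right zero_le (mul_le_one' (by split_ifs <;> simp) ?_)
      refine pow_le_one₀ zero_le (ENNReal.ofReal_le_one.2 ?_)
      rw [div_le_one (Real.sqrt_pos.2 (by exact_mod_cast x.one_le_size))]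
      exact Real.one_le_sqrt.2 (by exact_mod_cast x.one_le_size)
    · rw [ENNReal.one_le_ofReal]
      simp only [Nat.cast_one, one_pow, div_one]
      linarith [show 0 < K * 3 ^ (b + 1) by positivity]
  · have hs : 1 ≤ τ / 2 := by omega
    have hs0 : (0 : ℝ) < (τ / 2 : ℕ) := by exact_mod_cast hs
    refine le_trans (ENNReal.tsum_le_tsum fun x => ?_) ((hle _ hs).trans
      (ENNReal.ofReal_le_ofReal ?_))
    · gcongr
      split_ifs with h1 h2 h2
      · exact le_rfl
      · omega
      · exact zero_le
      · exact zero_le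
    · rw [div_le_div_iff₀ (by positivity) (by positivity)]
      have h3 : (τ : ℝ) ≤ 3 * (τ / 2 : ℕ) := by exact_mod_cast (by omega : τ ≤ 3 * (τ / 2))
      calc K * (τ : ℝ) ^ (b + 1) ≤ K * (3 * (τ / 2 : ℕ)) ^ (b + 1) := by gcongr
        _ = K * 3 ^ (b + 1) * ((τ / 2 : ℕ) : ℝ) ^ (b + 1) := by rw [mul_pow]; ring
        _ ≤ _ := by gcongr; linarith

end IsCriticalLaw

namespace IsCriticalLaw

variable {p : ℕ → ℝ}

lemma zero_pos (h : IsCriticalLaw p) : 0 < p 0 := by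
  refine lt_of_le_of_ne (h.nonneg 0) fun h0 => ?_
  have key : ∑' i : ℕ, (((i : ℝ) * p i) - p i) = 0 := by
    rw [h.summable_mean.tsum_sub h.summable, h.mean_eq, h.tsum_eq, sub_self]
  have hnn : ∀ i : ℕ, 0 ≤ ((i : ℝ) * p i) - p i := by
    intro i
    rcases i with _ | i
    · simp [← h0]
    · push_cast
      nlinarith [mul_nonneg (Nat.cast_nonneg (α := ℝ) i) (h.nonneg (i + 1))]
  obtain ⟨i, hi, hpi⟩ := exists_two_le_pos h.nonneg h.mean_eq h.one_lt_sq
  refine absurd key (ne_of_gt ((h.summable_mean.sub h.summable).tsum_pos hnn i ?_))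
  have : (2 : ℝ) ≤ i := by exact_mod_cast hi
  nlinarith

/-- The subgroup of the integers generated by the support of `p`. -/
def supportSubgroup (p : ℕ → ℝ) : AddSubgroup ℤ :=
  AddSubgroup.closure {x | ∃ j : ℕ, x = j ∧ p j ≠ 0}

lemma exists_span (h : IsCriticalLaw p) :
    ∃ d : ℕ, 0 < d ∧ (d : ℤ) ∈ supportSubgroup p ∧ ∀ x ∈ supportSubgroup p, (d : ℤ) ∣ x := by
  obtain ⟨a, ha⟩ := Int.subgroup_cyclic (supportSubgroup p)
  rw [← AddSubgroup.zmultiples_eq_closure, ← Int.zmultiples_natAbs] at ha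
  refine ⟨a.natAbs, ?_, ?_, ?_⟩
  · obtain ⟨i, hi, hpi⟩ := exists_two_le_pos h.nonneg h.mean_eq h.one_lt_sq
    have hmem : (i : ℤ) ∈ supportSubgroup p :=
      AddSubgroup.subset_closure ⟨i, rfl, hpi.ne'⟩
    rw [ha, Int.mem_zmultiples_iff] at hmem
    rcases Nat.eq_zero_or_pos a.natAbs with h0 | h0
    · rw [h0] at hmem
      simp only [Nat.cast_zero, zero_dvd_iff] at hmem
      omega
    · exact h0
  · rw [ha]
    exact AddSubgroup.mem_zmultiples _
  · intro x hx
    rwa [ha, Int.mem_zmultiples_iff] at hx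

lemma mem_supportSubgroup_of_walkCoeff_ne {n N : ℕ} (hN : walkCoeff p n N ≠ 0) :
    (N : ℤ) ∈ supportSubgroup p := by
  induction n generalizing N with
  | zero =>
    rw [walkCoeff_zero] at hN
    obtain rfl : N = 0 := by
      by_contra h0
      exact hN (if_neg h0)
    exact (supportSubgroup p).zero_mem
  | succ n ih =>
    rw [walkCoeff_succ] at hN
    obtain ⟨d, hd, hne⟩ := exists_ne_zero_of_sum_ne_zero hN
    rw [mem_range] at hd
    have h1 := ih (right_ne_zero_of_mul hne)
    have h2 : (d : ℤ) ∈ supportSubgroup p :=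
      AddSubgroup.subset_closure ⟨d, rfl, left_ne_zero_of_mul hne⟩
    have h3 := (supportSubgroup p).add_mem h2 h1
    rwa [← Nat.cast_add, Nat.add_sub_cancel' (by omega)] at h3

/-- The characteristic function of `p`. -/
noncomputable def charFn (p : ℕ → ℝ) (θ : ℝ) : ℂ :=
  ∑' j : ℕ, (p j : ℂ) * Complex.exp (θ * Complex.I) ^ j

lemma norm_term (h : IsCriticalLaw p) (θ : ℝ) (j : ℕ) :
    ‖(p j : ℂ) * Complex.exp (θ * Complex.I) ^ j‖ = p j := by
  rw [norm_mul, norm_pow, Complex.norm_exp_ofReal_mul_I, one_pow, mul_one, Complex.norm_real,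
    Real.norm_of_nonneg (h.nonneg j)]

lemma norm_charFn_le_one (h : IsCriticalLaw p) (θ : ℝ) : ‖charFn p θ‖ ≤ 1 := by
  refine (norm_tsum_le_tsum_norm ?_).trans (le_of_eq ?_)
  · simpa only [h.norm_term] using h.summable
  · simpa only [h.norm_term] using h.tsum_eq

lemma norm_add_mul_exp_le {a b : ℝ} (ha : 0 < a) (hb : 0 < b) (hab : a + b ≤ 1) (x : ℝ) :
    ‖(a : ℂ) + b * Complex.exp (x * Complex.I)‖ ≤ a + b - a * b * (1 - Real.cos x) := by
  have hc1 := Real.cos_le_one x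
  have hc2 := Real.neg_one_le_cos x
  have h4 : 0 ≤ (a - b) ^ 2 := sq_nonneg _
  have hpos : 0 ≤ a + b - a * b * (1 - Real.cos x) := by
    nlinarith [mul_pos ha hb]
  refine le_of_sq_le_sq ?_ hpos
  rw [← Complex.normSq_eq_norm_sq, Complex.exp_mul_I, Complex.normSq_apply]
  simp only [← Complex.ofReal_cos, ← Complex.ofReal_sin, Complex.add_re, Complex.mul_re,
    Complex.ofReal_re, Complex.I_re, Complex.I_im, Complex.ofReal_im, Complex.add_im,
    Complex.mul_im, mul_zero, zero_mul, sub_zero, mul_one, zero_add, add_zero, sub_self]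
  have hsc := Real.sin_sq_add_cos_sq x
  have h5 : 0 ≤ a * b * (1 - Real.cos x) * (1 - (a + b)) :=
    mul_nonneg (mul_nonneg (mul_pos ha hb).le (by linarith)) (by linarith)
  have h6 : b * Real.sin x * (b * Real.sin x) = b ^ 2 * (1 - Real.cos x ^ 2) := by
    rw [← hsc]
    ring
  rw [h6]
  nlinarith [sq_nonneg (a * b * (1 - Real.cos x))]

lemma one_sub_cos_le_of_ne (h : IsCriticalLaw p) {j : ℕ} (hj : p j ≠ 0) :
    ∃ C : ℝ, 0 ≤ C ∧ ∀ θ : ℝ, 1 - Real.cos (j * θ) ≤ C * (1 - ‖charFn p θ‖) := by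
  rcases Nat.eq_zero_or_pos j with rfl | hj0
  · exact ⟨0, le_rfl, fun θ => by simp⟩
  have hp0 := h.zero_pos
  have hpj : 0 < p j := lt_of_le_of_ne (h.nonneg j) hj.symm
  refine ⟨(p 0 * p j)⁻¹, by positivity, fun θ => ?_⟩
  have hsum : Summable (fun j : ℕ => (p j : ℂ) * Complex.exp (θ * Complex.I) ^ j) := by
    refine Summable.of_norm ?_
    simpa only [h.norm_term] using h.summable
  have hne : (0 : ℕ) ∉ ({j} : Finset ℕ) := by simp; omega
  have e1 := h.summable.sum_add_tsum_compl (s := insert 0 {j})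
  have e2 := hsum.sum_add_tsum_compl (s := insert 0 {j})
  rw [sum_insert hne, sum_singleton, h.tsum_eq] at e1
  rw [sum_insert hne, sum_singleton] at e2
  have hrest : ‖∑' x : ↑((↑(insert 0 {j} : Finset ℕ) : Set ℕ)ᶜ),
      (p x : ℂ) * Complex.exp (θ * Complex.I) ^ (x : ℕ)‖ ≤
      ∑' x : ↑((↑(insert 0 {j} : Finset ℕ) : Set ℕ)ᶜ), p x := by
    refine (norm_tsum_le_tsum_norm ?_).trans (le_of_eq ?_)
    · simp only [h.norm_term]
      exact h.summable.subtype _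
    · simp only [h.norm_term]
  have hrest0 : 0 ≤ ∑' x : ↑((↑(insert 0 {j} : Finset ℕ) : Set ℕ)ᶜ), p x :=
    tsum_nonneg fun x => h.nonneg x
  have hmain := norm_add_mul_exp_le hp0 hpj (by linarith) (j * θ)
  have e3 : (p 0 : ℂ) * Complex.exp (θ * Complex.I) ^ 0 +
      (p j : ℂ) * Complex.exp (θ * Complex.I) ^ j =
      (p 0 : ℂ) + p j * Complex.exp ((j * θ : ℝ) * Complex.I) := by
    rw [pow_zero, mul_one, ← Complex.exp_nat_mul]
    push_cast
    ring_nf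
  rw [e3] at e2
  have hφ : ‖charFn p θ‖ ≤ 1 - p 0 * p j * (1 - Real.cos (j * θ)) := by
    rw [charFn, ← e2]
    refine (norm_add_le _ _).trans ?_
    linarith
  rw [inv_mul_eq_div, le_div_iff₀ (by positivity)]
  linarith

lemma one_sub_cos_add_le (a b : ℝ) :
    1 - Real.cos (a + b) ≤ 2 * (1 - Real.cos a) + 2 * (1 - Real.cos b) := by
  have e : ∀ x : ℝ, 1 - Real.cos x = 2 * Real.sin (x / 2) ^ 2 := by
    intro x
    have h1 := Real.cos_sq (x / 2)
    rw [mul_div_cancel₀ x two_ne_zero] at h1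
    have h2 := Real.sin_sq_add_cos_sq (x / 2)
    linarith
  rw [e, e, e, add_div, Real.sin_add]
  set u := Real.sin (a / 2)
  set v := Real.sin (b / 2)
  have h1 : Real.cos (a / 2) ^ 2 ≤ 1 := Real.cos_sq_le_one _
  have h2 : Real.cos (b / 2) ^ 2 ≤ 1 := Real.cos_sq_le_one _
  nlinarith [sq_nonneg (u * Real.cos (b / 2) - Real.cos (a / 2) * v),
    mul_le_mul_of_nonneg_left h1 (sq_nonneg v), mul_le_mul_of_nonneg_left h2 (sq_nonneg u)]

lemma one_sub_cos_le (h : IsCriticalLaw p) {x : ℤ} (hx : x ∈ supportSubgroup p) :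
    ∃ C : ℝ, 0 ≤ C ∧ ∀ θ : ℝ, 1 - Real.cos (x * θ) ≤ C * (1 - ‖charFn p θ‖) := by
  induction hx using AddSubgroup.closure_induction with
  | mem x hx =>
    obtain ⟨j, rfl, hj⟩ := hx
    simpa using h.one_sub_cos_le_of_ne hj
  | zero => exact ⟨0, le_rfl, fun θ => by simp⟩
  | add x y _ _ hx hy =>
    obtain ⟨C, hC, hCx⟩ := hx
    obtain ⟨D, hD, hDy⟩ := hy
    refine ⟨2 * C + 2 * D, by positivity, fun θ => ?_⟩
    push_cast
    rw [add_mul]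
    have := one_sub_cos_add_le (x * θ) (y * θ)
    linarith [hCx θ, hDy θ]
  | neg x _ hx =>
    obtain ⟨C, hC, hCx⟩ := hx
    refine ⟨C, hC, fun θ => ?_⟩
    push_cast
    rw [neg_mul, Real.cos_neg]
    exact hCx θ

lemma exists_norm_charFn_le (h : IsCriticalLaw p) {d : ℕ} (hd : 0 < d)
    (hmem : (d : ℤ) ∈ supportSubgroup p) :
    ∃ c : ℝ, 0 < c ∧ ∀ θ : ℝ, |θ| ≤ Real.pi / d → ‖charFn p θ‖ ≤ Real.exp (-(c * θ ^ 2)) := by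
  obtain ⟨C, hC, hle⟩ := h.one_sub_cos_le hmem
  have hd' : (0 : ℝ) < d := by exact_mod_cast hd
  have hpi := Real.pi_pos
  refine ⟨2 / Real.pi ^ 2 * d ^ 2 / (C + 1), by positivity, fun θ hθ => ?_⟩
  have h1 := hle θ
  have hn := h.norm_charFn_le_one θ
  have h2 : Real.cos (d * θ) ≤ 1 - 2 / Real.pi ^ 2 * (d * θ) ^ 2 := by
    refine Real.cos_le_one_sub_mul_cos_sq ?_
    rw [abs_mul, abs_of_pos hd']
    rw [le_div_iff₀ hd'] at hθ
    linarith
  push_cast at h1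
  refine le_trans ?_ (Real.one_sub_le_exp_neg _)
  have h3 : 2 / Real.pi ^ 2 * d ^ 2 / (C + 1) * θ ^ 2 ≤ 1 - ‖charFn p θ‖ := by
    rw [div_mul_eq_mul_div, div_le_iff₀ (by positivity)]
    nlinarith
  linarith

end IsCriticalLaw

namespace IsCriticalLaw

variable {p : ℕ → ℝ}

lemma summable_walkCoeff (h : IsCriticalLaw p) (n : ℕ) : Summable (walkCoeff p n) := by
  induction n with
  | zero =>
    rw [(funext (walkCoeff_zero p) : walkCoeff p 0 = _)]
    exact (hasSum_ite_eq 0 1).summable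
  | succ n ih =>
    have := summable_norm_sum_mul_range_of_summable_norm (f := p) (g := walkCoeff p n)
      h.summable.norm ih.norm
    refine this.of_norm.congr fun N => ?_
    rw [walkCoeff_succ]

lemma walkCoeff_le_one (h : IsCriticalLaw p) (n N : ℕ) : walkCoeff p n N ≤ 1 := by
  have hsum : ∑' N, walkCoeff p n N = 1 := by
    induction n with
    | zero => simp [walkCoeff_zero]
    | succ n ih =>
      have := tsum_mul_tsum_eq_tsum_sum_range_of_summable_norm (f := p) (g := walkCoeff p n)
        h.summable.norm (h.summable_walkCoeff n).norm
      rw [h.tsum_eq, ih, one_mul] at this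
      rw [this]
      exact tsum_congr fun N => walkCoeff_succ p n N
  rw [← hsum]
  exact (h.summable_walkCoeff n).le_tsum N fun j _ => walkCoeff_nonneg h.nonneg n j

lemma norm_walkCoeff_term (h : IsCriticalLaw p) (n : ℕ) (θ : ℝ) (N : ℕ) :
    ‖(walkCoeff p n N : ℂ) * Complex.exp (θ * Complex.I) ^ N‖ = walkCoeff p n N := by
  rw [norm_mul, norm_pow, Complex.norm_exp_ofReal_mul_I, one_pow, mul_one, Complex.norm_real,
    Real.norm_of_nonneg (walkCoeff_nonneg h.nonneg _ _)]

lemma charFn_pow_hasSum (h : IsCriticalLaw p) (n : ℕ) (θ : ℝ) :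
    HasSum (fun N : ℕ => (walkCoeff p n N : ℂ) * Complex.exp (θ * Complex.I) ^ N)
      (charFn p θ ^ n) := by
  have hs : ∀ n, Summable fun N : ℕ =>
      ‖(walkCoeff p n N : ℂ) * Complex.exp (θ * Complex.I) ^ N‖ := fun n => by
    simpa only [h.norm_walkCoeff_term] using h.summable_walkCoeff n
  have hs1 : Summable fun j : ℕ => ‖(p j : ℂ) * Complex.exp (θ * Complex.I) ^ j‖ := by
    simpa only [h.norm_term] using h.summable
  rw [(hs n).of_norm.hasSum_iff]
  induction n with
  | zero =>
    rw [tsum_eq_single 0]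
    · simp [walkCoeff_zero]
    · intro N hN
      simp [walkCoeff_zero, hN]
  | succ n ih =>
    rw [pow_succ', ← ih, charFn,
      tsum_mul_tsum_eq_tsum_sum_range_of_summable_norm hs1 (hs n)]
    refine tsum_congr fun N => ?_
    rw [walkCoeff_succ, Complex.ofReal_sum, sum_mul]
    refine sum_congr rfl fun d hd => ?_
    rw [mem_range] at hd
    rw [← Nat.add_sub_cancel' (show d ≤ N by omega)]
    rw [pow_add, Nat.add_sub_cancel_left]
    push_cast
    ring

lemma continuous_charFn (h : IsCriticalLaw p) : Continuous (charFn p) := by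
  refine continuous_tsum (fun j => by fun_prop) h.summable fun j θ => ?_
  rw [h.norm_term]

lemma integral_exp_int_mul {d : ℕ} (hd : 0 < d) {m : ℤ} (hm : (d : ℤ) ∣ m) :
    ∫ θ in (-(Real.pi / d))..(Real.pi / d), Complex.exp (m * Complex.I * θ) =
      if m = 0 then ((2 * Real.pi / d : ℝ) : ℂ) else 0 := by
  split_ifs with h0
  · subst h0
    simp only [Int.cast_zero, zero_mul, Complex.exp_zero, intervalIntegral.integral_const]
    rw [sub_neg_eq_add, Complex.real_smul, mul_one]
    congr 1
    ring
  · obtain ⟨l, rfl⟩ := hm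
    have hd' : (d : ℂ) ≠ 0 := by exact_mod_cast hd.ne'
    rw [integral_exp_mul_complex (mul_ne_zero (by exact_mod_cast h0) Complex.I_ne_zero)]
    rw [div_eq_zero_iff]
    left
    rw [sub_eq_zero, Complex.exp_eq_exp_iff_exists_int]
    refine ⟨l, ?_⟩
    push_cast
    field_simp
    ring

lemma integral_charFn_pow (h : IsCriticalLaw p) {d : ℕ} (hd : 0 < d)
    (hdvd : ∀ x ∈ supportSubgroup p, (d : ℤ) ∣ x) (n : ℕ) {N : ℕ} (hN : d ∣ N) :
    ∫ θ in (-(Real.pi / d))..(Real.pi / d),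
        charFn p θ ^ n * Complex.exp (-(N * Complex.I * θ)) =
      ((walkCoeff p n N * (2 * Real.pi / d) : ℝ) : ℂ) := by
  have hterm : ∀ (θ : ℝ) (M : ℕ), (walkCoeff p n M : ℂ) * Complex.exp (θ * Complex.I) ^ M *
      Complex.exp (-(N * Complex.I * θ)) =
      walkCoeff p n M * Complex.exp (((M : ℤ) - (N : ℤ) : ℤ) * Complex.I * θ) := by
    intro θ M
    rw [mul_assoc, ← Complex.exp_nat_mul, ← Complex.exp_add]
    congr 2
    push_cast
    ring
  have hnorm : ∀ (θ : ℝ) (m : ℤ), ‖Complex.exp (m * Complex.I * θ)‖ = 1 := by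
    intro θ m
    rw [show (m : ℂ) * Complex.I * θ = ((m * θ : ℝ) : ℂ) * Complex.I by push_cast; ring,
      Complex.norm_exp_ofReal_mul_I]
  have key := intervalIntegral.hasSum_integral_of_dominated_convergence
    (μ := MeasureTheory.volume) (a := -(Real.pi / d)) (b := Real.pi / d)
    (F := fun (M : ℕ) (θ : ℝ) =>
      (walkCoeff p n M : ℂ) * Complex.exp (((M : ℤ) - (N : ℤ) : ℤ) * Complex.I * θ))
    (f := fun θ => charFn p θ ^ n * Complex.exp (-(N * Complex.I * θ)))
    (fun M _ => walkCoeff p n M)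
    (fun M => by
      refine Continuous.aestronglyMeasurable ?_
      fun_prop)
    (fun M => Filter.Eventually.of_forall fun θ _ => by
      rw [norm_mul, hnorm, mul_one, Complex.norm_real,
        Real.norm_of_nonneg (walkCoeff_nonneg h.nonneg _ _)])
    (Filter.Eventually.of_forall fun θ _ => h.summable_walkCoeff n)
    intervalIntegrable_const
    (Filter.Eventually.of_forall fun θ _ => by
      simpa only [hterm] using (h.charFn_pow_hasSum n θ).mul_right
        (Complex.exp (-(N * Complex.I * θ))))
  rw [← key.tsum_eq, tsum_eq_single N]
  · rw [intervalIntegral.integral_const_mul, integral_exp_int_mul hd (by simp)]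
    simp
  · intro M hM
    rw [intervalIntegral.integral_const_mul]
    by_cases hz : walkCoeff p n M = 0
    · rw [hz]; simp
    · have h1 := hdvd _ (mem_supportSubgroup_of_walkCoeff_ne hz)
      rw [integral_exp_int_mul hd (dvd_sub h1 (by exact_mod_cast hN)), if_neg (by omega), mul_zero]

/-- The uniform upper bound in the local limit theorem. -/
lemma exists_walkCoeff_le (h : IsCriticalLaw p) :
    ∃ C : ℝ, 0 < C ∧ ∀ n N : ℕ, walkCoeff p n N ≤ C / √(n + 1) := by
  obtain ⟨d, hd, hmem, hdvd⟩ := h.exists_span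
  obtain ⟨c, hc, hle⟩ := h.exists_norm_charFn_le hd hmem
  have hd' : (0 : ℝ) < d := by exact_mod_cast hd
  have hpi := Real.pi_pos
  set A := d / (2 * Real.pi) * √(Real.pi / c) with hA
  have hA0 : 0 < A := by positivity
  have hmain : ∀ n N : ℕ, 1 ≤ n → walkCoeff p n N ≤ A / √n := by
    intro n N hn
    have hn' : (0 : ℝ) < n := by exact_mod_cast hn
    by_cases hz : walkCoeff p n N = 0
    · rw [hz]; positivity
    have hN : d ∣ N := by exact_mod_cast hdvd _ (mem_supportSubgroup_of_walkCoeff_ne hz)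
    have e := h.integral_charFn_pow hd hdvd n hN
    have hle2 : walkCoeff p n N * (2 * Real.pi / d) ≤ √(Real.pi / (n * c)) := by
      calc walkCoeff p n N * (2 * Real.pi / d)
          = ‖∫ θ in (-(Real.pi / d))..(Real.pi / d),
              charFn p θ ^ n * Complex.exp (-(N * Complex.I * θ))‖ := by
            rw [e, Complex.norm_real, Real.norm_of_nonneg]
            exact mul_nonneg (walkCoeff_nonneg h.nonneg _ _) (by positivity)
        _ ≤ ∫ θ in (-(Real.pi / d))..(Real.pi / d), Real.exp (-(n * c) * θ ^ 2) := by
            refine intervalIntegral.norm_integral_le_of_norm_le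
              (by linarith [show 0 < Real.pi / d by positivity]) ?_ ?_
            · refine Filter.Eventually.of_forall fun θ hθ => ?_
              have hexp : ‖Complex.exp (-(N * Complex.I * θ))‖ = 1 := by
                rw [show -((N : ℂ) * Complex.I * θ) = ((-(N * θ) : ℝ) : ℂ) * Complex.I by
                  push_cast; ring, Complex.norm_exp_ofReal_mul_I]
              rw [norm_mul, hexp, mul_one, norm_pow]
              refine (pow_le_pow_left₀ (norm_nonneg _)
                (hle θ (abs_le.2 ⟨hθ.1.le, hθ.2⟩)) n).trans (le_of_eq ?_)
              rw [← Real.exp_nat_mul]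
              congr 1
              ring
            · exact (Continuous.intervalIntegrable (by fun_prop) _ _)
        _ ≤ ∫ θ, Real.exp (-(n * c) * θ ^ 2) := by
            rw [intervalIntegral.integral_of_le
              (by linarith [show 0 < Real.pi / d by positivity])]
            exact MeasureTheory.setIntegral_le_integral
              (integrable_exp_neg_mul_sq (by positivity))
              (Filter.Eventually.of_forall fun θ => Real.exp_nonneg _)
        _ = _ := integral_gaussian _
    have e2 : √(Real.pi / (n * c)) = √(Real.pi / c) / √n := by
      rw [← Real.sqrt_div' _ hn'.le]
      congr 1
      field_simp
    rw [e2, ← le_div_iff₀ (by positivity)] at hle2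
    refine hle2.trans (le_of_eq ?_)
    rw [hA]
    field_simp
  refine ⟨2 * A + 1, by positivity, fun n N => ?_⟩
  rcases Nat.eq_zero_or_pos n with rfl | hn
  · refine (h.walkCoeff_le_one 0 N).trans ?_
    simp only [Nat.cast_zero, zero_add, Real.sqrt_one, div_one]
    linarith
  · refine (hmain n N hn).trans ?_
    have hn' : (1 : ℝ) ≤ n := by exact_mod_cast hn
    rw [div_le_div_iff₀ (by positivity) (by positivity)]
    have h1 : √((n : ℝ) + 1) ≤ 2 * √n := by
      rw [Real.sqrt_le_left (by positivity), mul_pow, Real.sq_sqrt (by positivity)]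
      linarith
    nlinarith [Real.sqrt_nonneg (n : ℝ)]

end IsCriticalLaw

namespace IsCriticalLaw

variable {p : ℕ → ℝ}

/-- The offspring law as a probability mass function. -/
noncomputable def toPMF (h : IsCriticalLaw p) : PMF ℕ :=
  ⟨fun j => ENNReal.ofReal (p j), by
    have := ENNReal.summable.hasSum (f := fun j => ENNReal.ofReal (p j))
    rwa [← ENNReal.ofReal_tsum_of_nonneg h.nonneg h.summable, h.tsum_eq,
      ENNReal.ofReal_one] at this⟩

lemma toPMF_apply_toReal (h : IsCriticalLaw p) (j : ℕ) : (h.toPMF j).toReal = p j :=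
  ENNReal.toReal_ofReal (h.nonneg j)

lemma integrable_toPMF (h : IsCriticalLaw p) {E : Type*} [NormedAddCommGroup E] {f : ℕ → E}
    (hf : Summable fun j => p j * ‖f j‖) :
    MeasureTheory.Integrable f h.toPMF.toMeasure := by
  refine ⟨MeasureTheory.StronglyMeasurable.of_discrete.aestronglyMeasurable, ?_⟩
  rw [MeasureTheory.hasFiniteIntegral_iff_enorm, MeasureTheory.lintegral_countable']
  have e : ∀ j, ‖f j‖ₑ * h.toPMF.toMeasure {j} = ENNReal.ofReal (p j * ‖f j‖) := by
    intro j
    rw [PMF.toMeasure_apply_singleton _ _ (measurableSet_singleton j),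
      ENNReal.ofReal_mul (h.nonneg j), mul_comm, ofReal_norm]
    rfl
  simp only [e]
  rw [← ENNReal.ofReal_tsum_of_nonneg
    (fun j => mul_nonneg (h.nonneg j) (norm_nonneg _)) hf]
  exact ENNReal.ofReal_lt_top

lemma integral_toPMF (h : IsCriticalLaw p) {E : Type*} [NormedAddCommGroup E] [NormedSpace ℝ E]
    [CompleteSpace E] {f : ℕ → E} (hf : Summable fun j => p j * ‖f j‖) :
    ∫ j, f j ∂h.toPMF.toMeasure = ∑' j, p j • f j := by
  rw [PMF.integral_eq_tsum _ _ (h.integrable_toPMF hf)]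
  simp only [h.toPMF_apply_toReal]

/-- The standard deviation of the offspring law. -/
noncomputable def stdDev (p : ℕ → ℝ) : ℝ := √(∑' i : ℕ, (i : ℝ) ^ 2 * p i - 1)

lemma stdDev_pos (h : IsCriticalLaw p) : 0 < stdDev p :=
  Real.sqrt_pos.2 (by linarith [h.one_lt_sq])

lemma stdDev_sq (h : IsCriticalLaw p) : stdDev p ^ 2 = ∑' i : ℕ, (i : ℝ) ^ 2 * p i - 1 :=
  Real.sq_sqrt (by linarith [h.one_lt_sq])

lemma hasSum_centered_sq (h : IsCriticalLaw p) :
    HasSum (fun j : ℕ => p j * ((j : ℝ) - 1) ^ 2) (stdDev p ^ 2) := by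
  have := (h.summable_sq.hasSum.sub (h.summable_mean.hasSum.mul_left 2)).add h.summable.hasSum
  rw [h.mean_eq, h.tsum_eq] at this
  rw [h.stdDev_sq]
  convert! this using 1
  · funext j; ring
  · ring

lemma tendsto_charFn_pow (h : IsCriticalLaw p) (y : ℝ) :
    Filter.Tendsto
      (fun n : ℕ => (charFn p (y / √n) * Complex.exp (-((y / √n : ℝ) * Complex.I))) ^ n)
      Filter.atTop (nhds (Complex.exp (-(stdDev p * y : ℝ) ^ 2 / 2))) := by
  have hσ := h.stdDev_pos
  set X : ℕ → ℝ := fun j => ((j : ℝ) - 1) / stdDev p with hX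
  have hnorm1 : Summable fun j => p j * ‖X j‖ := by
    refine ((h.summable_mean.add h.summable).mul_right (stdDev p)⁻¹).of_nonneg_of_le
      (fun j => mul_nonneg (h.nonneg j) (norm_nonneg _)) fun j => ?_
    rw [hX, norm_div, Real.norm_of_nonneg hσ.le, div_eq_mul_inv, ← mul_assoc]
    gcongr
    have : ‖(j : ℝ) - 1‖ ≤ j + 1 := by
      refine (norm_sub_le _ _).trans (le_of_eq ?_)
      simp
    nlinarith [h.nonneg j]
  have hsq : HasSum (fun j => p j * X j ^ 2) 1 := by
    have := h.hasSum_centered_sq.mul_right ((stdDev p ^ 2)⁻¹)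
    rw [mul_inv_cancel₀ (by positivity)] at this
    convert! this using 1
    funext j
    rw [hX, div_pow]
    ring
  have h0 : ∫ j, X j ∂h.toPMF.toMeasure = 0 := by
    rw [h.integral_toPMF hnorm1]
    have := (h.summable_mean.hasSum.sub h.summable.hasSum).mul_right (stdDev p)⁻¹
    rw [h.mean_eq, h.tsum_eq, sub_self, zero_mul] at this
    rw [← this.tsum_eq]
    refine tsum_congr fun j => ?_
    rw [hX, smul_eq_mul]
    ring
  have h1 : ∫ j, (X ^ 2) j ∂h.toPMF.toMeasure = 1 := by
    rw [h.integral_toPMF, ← hsq.tsum_eq]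
    · rfl
    · simpa using hsq.summable
  have key := ProbabilityTheory.tendsto_charFun_inv_sqrt_mul_pow (P := h.toPMF.toMeasure)
    (X := X) (measurable_of_countable _).aemeasurable h0 h1 (stdDev p * y)
  refine (Filter.tendsto_congr fun n => ?_).1 key
  congr 1
  rw [MeasureTheory.charFun_apply_real, MeasureTheory.integral_map
    (measurable_of_countable _).aemeasurable (by fun_prop), h.integral_toPMF, charFn,
    ← tsum_mul_right]
  · refine tsum_congr fun j => ?_
    rw [← Complex.exp_nat_mul, mul_assoc, mul_assoc, ← Complex.exp_add, Complex.real_smul]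
    congr 2
    rw [hX]
    have : (stdDev p : ℂ) ≠ 0 := by exact_mod_cast hσ.ne'
    push_cast
    field_simp
    ring
  · refine h.summable.congr fun j => ?_
    rw [← Complex.ofReal_mul, Complex.norm_exp_ofReal_mul_I, mul_one]

lemma sqrt_mul_integral_eq (g : ℝ → ℂ) {L : ℝ} (hL : 0 ≤ L) {n : ℕ} (hn : 0 < n) :
    (√n : ℂ) * ∫ θ in (-L)..L, g θ =
      ∫ y, (Set.Ioc (-L) L).indicator g (y / √n) := by
  have hn' : 0 < √(n : ℝ) := Real.sqrt_pos.2 (by exact_mod_cast hn)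
  rw [MeasureTheory.Measure.integral_comp_div, abs_of_pos hn', Complex.real_smul,
    MeasureTheory.integral_indicator measurableSet_Ioc,
    intervalIntegral.integral_of_le (by linarith)]

lemma tendsto_sqrt_mul_walkCoeff (h : IsCriticalLaw p) {d : ℕ} (hd : 0 < d)
    (hmem : (d : ℤ) ∈ supportSubgroup p) :
    Filter.Tendsto (fun n : ℕ => (√n : ℂ) * ∫ θ in (-(Real.pi / d))..(Real.pi / d),
      charFn p θ ^ n * Complex.exp (-(((n - 1 : ℕ) : ℂ) * Complex.I * θ))) Filter.atTop
      (nhds ((∫ y : ℝ, Real.exp (-(stdDev p ^ 2 / 2) * y ^ 2) : ℝ) : ℂ)) := by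
  obtain ⟨c, hc, hle⟩ := h.exists_norm_charFn_le hd hmem
  have hd' : (0 : ℝ) < d := by exact_mod_cast hd
  set L := Real.pi / d with hL
  have hL0 : 0 < L := by have := Real.pi_pos; positivity
  have hlim : Filter.Tendsto (fun n : ℕ => √(n : ℝ)) Filter.atTop Filter.atTop :=
    Real.tendsto_sqrt_atTop.comp tendsto_natCast_atTop_atTop
  rw [← integral_complex_ofReal]
  have hcongr : ∀ᶠ n : ℕ in Filter.atTop,
      ∫ y : ℝ, (Set.Ioc (-L) L).indicator (fun θ : ℝ =>
        charFn p θ ^ n * Complex.exp (-(((n - 1 : ℕ) : ℂ) * Complex.I * θ))) (y / √n) =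
      (√n : ℂ) * ∫ θ in (-L)..L,
        charFn p θ ^ n * Complex.exp (-(((n - 1 : ℕ) : ℂ) * Complex.I * θ)) := by
    filter_upwards [Filter.eventually_gt_atTop 0] with n hn
    rw [sqrt_mul_integral_eq _ hL0.le hn]
  refine (Filter.tendsto_congr' hcongr).1 ?_
  refine MeasureTheory.tendsto_integral_filter_of_dominated_convergence
    (fun y => Real.exp (-c * y ^ 2)) ?_ ?_ (integrable_exp_neg_mul_sq hc) ?_
  · refine Filter.Eventually.of_forall fun n => ?_
    have hm : Measurable ((Set.Ioc (-L) L).indicator (fun θ : ℝ =>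
        charFn p θ ^ n * Complex.exp (-(((n - 1 : ℕ) : ℂ) * Complex.I * θ)))) := by
      refine Measurable.indicator (Continuous.measurable ?_) measurableSet_Ioc
      have := h.continuous_charFn
      fun_prop
    exact (hm.comp (measurable_id.div_const _)).aestronglyMeasurable
  · filter_upwards [Filter.eventually_gt_atTop 0] with n hn
    refine Filter.Eventually.of_forall fun y => ?_
    have hn' : (0 : ℝ) < n := by exact_mod_cast hn
    rw [Set.indicator_apply]
    split_ifs with hy
    · have hexp : ‖Complex.exp (-(((n - 1 : ℕ) : ℂ) * Complex.I * (y / √n : ℝ)))‖ = 1 := by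
        rw [show -(((n - 1 : ℕ) : ℂ) * Complex.I * (y / √n : ℝ)) =
          ((-((n - 1 : ℕ) * (y / √n)) : ℝ) : ℂ) * Complex.I by
            push_cast; ring, Complex.norm_exp_ofReal_mul_I]
      rw [norm_mul, hexp, mul_one, norm_pow]
      refine (pow_le_pow_left₀ (norm_nonneg _)
        (hle _ (abs_le.2 ⟨hy.1.le, hy.2⟩)) n).trans (le_of_eq ?_)
      rw [← Real.exp_nat_mul, div_pow, Real.sq_sqrt hn'.le]
      congr 1
      field_simp
    · rw [norm_zero]
      positivity
  · refine Filter.Eventually.of_forall fun y => ?_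
    have h1 := h.tendsto_charFn_pow y
    have h2 : Filter.Tendsto (fun n : ℕ => y / √(n : ℝ)) Filter.atTop (nhds 0) :=
      hlim.const_div_atTop y
    have h3 : Filter.Tendsto (fun n : ℕ => Complex.exp (((y / √(n : ℝ) : ℝ) : ℂ) * Complex.I))
        Filter.atTop (nhds 1) := by
      have hc : Continuous fun u : ℝ => Complex.exp ((u : ℂ) * Complex.I) := by fun_prop
      have := (hc.tendsto 0).comp h2
      rwa [Complex.ofReal_zero, zero_mul, Complex.exp_zero] at this
    have h4 := h1.mul h3
    have hev : ∀ᶠ n : ℕ in Filter.atTop, (0 < n ∧ |y / √(n : ℝ)| < L) := by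
      refine (Filter.eventually_gt_atTop 0).and ?_
      have := h2.abs
      rw [abs_zero] at this
      exact this.eventually (gt_mem_nhds hL0)
    have e : Complex.exp (-(stdDev p * y : ℝ) ^ 2 / 2) * 1 =
        ((Real.exp (-(stdDev p ^ 2 / 2) * y ^ 2) : ℝ) : ℂ) := by
      rw [mul_one]
      push_cast
      congr 1
      ring
    rw [e] at h4
    refine h4.congr' ?_
    filter_upwards [hev] with n hn
    have hy := abs_lt.1 hn.2
    rw [Set.indicator_of_mem (show y / √(n : ℝ) ∈ Set.Ioc (-L) L from ⟨hy.1, hy.2.le⟩), mul_pow,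
      mul_assoc, ← Complex.exp_nat_mul, ← Complex.exp_add]
    congr 2
    rw [Nat.cast_sub hn.1]
    push_cast
    ring

/-- The lower bound at the mean in the local limit theorem. -/
lemma exists_le_walkCoeff (h : IsCriticalLaw p) :
    ∃ c : ℝ, 0 < c ∧ ∀ n : ℕ, 1 ≤ n → 0 < walkCoeff p n (n - 1) →
      c / √n ≤ walkCoeff p n (n - 1) := by
  obtain ⟨d, hd, hmem, hdvd⟩ := h.exists_span
  have hd' : (0 : ℝ) < d := by exact_mod_cast hd
  have hpi := Real.pi_pos
  have hσ := h.stdDev_pos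
  set J := ∫ y : ℝ, Real.exp (-(stdDev p ^ 2 / 2) * y ^ 2) with hJ
  have hJ0 : 0 < J := by
    rw [hJ, integral_gaussian]
    positivity
  have hlim := (h.tendsto_sqrt_mul_walkCoeff hd hmem).norm
  rw [Complex.norm_real, Real.norm_of_nonneg hJ0.le] at hlim
  obtain ⟨n₀, hn₀⟩ := Filter.eventually_atTop.1 (hlim.eventually (lt_mem_nhds (half_lt_self hJ0)))
  have hlarge : ∀ n, n₀ ≤ n → 0 < walkCoeff p n (n - 1) →
      J / 2 * (d / (2 * Real.pi)) < √n * walkCoeff p n (n - 1) := by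
    intro n hn hpos
    have h1 := hn₀ n hn
    have hN : d ∣ n - 1 := by exact_mod_cast hdvd _ (mem_supportSubgroup_of_walkCoeff_ne hpos.ne')
    rw [h.integral_charFn_pow hd hdvd n hN, norm_mul, Complex.norm_real, Complex.norm_real,
      Real.norm_of_nonneg (Real.sqrt_nonneg _), Real.norm_of_nonneg (by positivity)] at h1
    calc J / 2 * (d / (2 * Real.pi))
        < √n * (walkCoeff p n (n - 1) * (2 * Real.pi / d)) * (d / (2 * Real.pi)) := by gcongr
      _ = _ := by field_simp
  have hsmall : ∀ m : ℕ, ∃ c : ℝ, 0 < c ∧ ∀ n, n < m → 1 ≤ n → 0 < walkCoeff p n (n - 1) →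
      c ≤ √n * walkCoeff p n (n - 1) := by
    intro m
    induction m with
    | zero => exact ⟨1, one_pos, fun n hn => by omega⟩
    | succ m ih =>
      obtain ⟨c, hc, hcn⟩ := ih
      by_cases hm : 1 ≤ m ∧ 0 < walkCoeff p m (m - 1)
      · have hm' : (0 : ℝ) < m := by exact_mod_cast hm.1
        refine ⟨min c (√m * walkCoeff p m (m - 1)),
          lt_min hc (mul_pos (Real.sqrt_pos.2 hm') hm.2), fun n hn h1 hpos => ?_⟩
        rcases (Nat.lt_succ_iff.1 hn).eq_or_lt with rfl | hlt
        · exact min_le_right _ _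
        · exact (min_le_left _ _).trans (hcn n hlt h1 hpos)
      · refine ⟨c, hc, fun n hn h1 hpos => ?_⟩
        rcases (Nat.lt_succ_iff.1 hn).eq_or_lt with rfl | hlt
        · exact absurd ⟨h1, hpos⟩ hm
        · exact hcn n hlt h1 hpos
  obtain ⟨c, hc, hcn⟩ := hsmall n₀
  refine ⟨min c (J / 2 * (d / (2 * Real.pi))), lt_min hc (by positivity), fun n h1 hpos => ?_⟩
  have hn' : (0 : ℝ) < n := by exact_mod_cast h1
  rw [div_le_iff₀ (Real.sqrt_pos.2 hn'), mul_comm (walkCoeff _ _ _)]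
  rcases Nat.lt_or_ge n n₀ with hlt | hge
  · exact (min_le_left _ _).trans (hcn n hlt h1 hpos)
  · exact (min_le_right _ _).trans (hlarge n hge hpos).le

end IsCriticalLaw

section Rank

lemma countP_add_one_le {α : Type*} {P Q : α → Bool} {l : List α} (h : ∀ a, P a → Q a) {i : α}
    (hi : i ∈ l) (hP : ¬ P i) (hQ : Q i) : l.countP P + 1 ≤ l.countP Q := by
  induction l with
  | nil => simp at hi
  | cons x l ih =>
    rw [List.countP_cons, List.countP_cons]
    rcases List.mem_cons.1 hi with rfl | hi
    · have := List.countP_mono_left (l := l) fun a _ => h a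
      rw [if_neg hP, if_pos hQ]
      omega
    · have := ih hi
      have := h x
      split_ifs <;> first | omega | simp_all

lemma rankIn_le (ts : List PTree) {i : ℕ} (hi : i < ts.length) :
    rankIn (ts.map PTree.size) i ≤
      1 + (ts.eraseIdx i).countP (fun z => ts[i].size ≤ z.size) := by
  set l := ts.map PTree.size with hl
  have hlen : l.length = ts.length := by rw [hl, List.length_map]
  have hget : l.getD i 0 = ts[i].size := by
    rw [List.getD_eq_getElem _ _ (by omega)]
    simp [hl]
  have hcount : ts.countP (fun z => ts[i].size ≤ z.size) =
      (List.range l.length).countP (fun j => ts[i].size ≤ l.getD j 0) := by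
    have e : (List.range l.length).map (fun j => l.getD j 0) = l := by
      refine List.ext_getElem (by simp) fun j h1 h2 => ?_
      rw [List.getElem_map, List.getElem_range, List.getD_eq_getElem]
    calc _ = l.countP (fun m => ts[i].size ≤ m) := by
          rw [hl, List.countP_map]
          rfl
      _ = ((List.range l.length).map (fun j => l.getD j 0)).countP
            (fun m => ts[i].size ≤ m) := by rw [e]
      _ = _ := by
          rw [List.countP_map]
          rfl
  have hperm := (perm_of_mem_picks (mem_picks ts i hi)).countP_eq (fun z => ts[i].size ≤ z.size)
  simp only [List.countP_cons, le_refl, decide_true, if_true] at hperm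
  have hle := countP_add_one_le (l := List.range l.length)
    (P := fun j => l.getD i 0 < l.getD j 0 ∨ (l.getD j 0 = l.getD i 0 ∧ j < i))
    (Q := fun j => ts[i].size ≤ l.getD j 0) (i := i)
    (by
      intro j hj
      rw [decide_eq_true_eq] at hj ⊢
      omega)
    (List.mem_range.2 (by omega)) (by simp) (by simp only [decide_eq_true_eq]; omega)
  rw [rankIn, ← List.countP_eq_length_filter]
  omega

/-- The subtrees rooted at the children of the root. -/
def PTree.children : PTree → List PTree
  | node ts => ts

/-- Some child of the root carries a subtree of height at least `τ` while at least `j` of its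
siblings carry subtrees that are not smaller. -/
def HasTallPick (τ j : ℕ) (T : PTree) : Prop :=
  ∃ q ∈ picks T.children, τ ≤ q.1.height ∧ j ≤ q.2.countP (fun z => q.1.size ≤ z.size)

lemma hasTallPick_of_le_Hstar {T : PTree} {t : ℝ} (ht : 1 ≤ t) {k ℓ : ℕ} (hk : k ≤ ℓ)
    (hH : t ≤ (Hstar T ℓ : ℝ)) : HasTallPick ⌈t⌉₊ (k - 1) T := by
  obtain ⟨ts⟩ := T
  rw [Hstar] at hH
  split at hH
  · rename_i i hfind
    have hi := List.mem_of_find?_eq_some hfind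
    rw [List.mem_range] at hi
    have hrank := List.find?_some hfind
    rw [decide_eq_true_eq] at hrank
    rw [List.getD_eq_getElem _ _ hi] at hH
    refine ⟨_, mem_picks ts i hi, Nat.ceil_le.2 hH, ?_⟩
    have := rankIn_le ts hi
    dsimp only
    omega
  · rw [Nat.cast_zero] at hH
    linarith

lemma exists_maximal_pick {L : List PTree} (hL : L ≠ []) :
    ∃ q ∈ picks L, ∀ z ∈ L, z.size ≤ q.1.size := by
  obtain ⟨y, hy, hmax⟩ : ∃ y ∈ L, ∀ z ∈ L, z.size ≤ y.size := by
    induction L with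
    | nil => exact absurd rfl hL
    | cons x L ih =>
      rcases eq_or_ne L [] with rfl | hne
      · exact ⟨x, by simp, by simp⟩
      · obtain ⟨y, hy, hmax⟩ := ih hne
        rcases le_total x.size y.size with h | h
        · exact ⟨y, List.mem_cons_of_mem _ hy, by
            simpa using ⟨h, hmax⟩⟩
        · exact ⟨x, by simp, by
            simpa using fun z hz => (hmax z hz).trans h⟩
  obtain ⟨L', hL'⟩ := exists_mem_picks hy
  exact ⟨_, hL', hmax⟩

lemma sum_size_le_length_mul {L : List PTree} {M : ℕ} (h : ∀ z ∈ L, z.size ≤ M) :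
    (L.map PTree.size).sum ≤ L.length * M := by
  have := List.sum_le_card_nsmul (L.map PTree.size) M (by simpa using h)
  simpa using this

/-- The largest sibling of a tall child of high rank contains a positive fraction of the tree. -/
lemma exists_giant_of_hasTallPick {ts : List PTree} {τ j : ℕ}
    (h : HasTallPick τ (j + 1) (.node ts)) :
    ∃ q ∈ picks ts, ∃ q' ∈ picks q.2, τ ≤ q.1.height ∧
      j ≤ q'.2.countP (fun z => q.1.size ≤ z.size) ∧
      (PTree.node ts).size ≤ 2 * ts.length * q'.1.size ∧
      (PTree.node ts).size = 1 + q.1.size + q'.1.size + (q'.2.map PTree.size).sum := by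
  obtain ⟨q, hq, hτ, hj⟩ := h
  change q ∈ picks ts at hq
  have hne : q.2 ≠ [] := by
    intro h0
    simp [h0] at hj
  obtain ⟨q', hq', hmax⟩ := exists_maximal_pick hne
  have hperm := perm_of_mem_picks hq
  have hperm' := perm_of_mem_picks hq'
  have hc := hperm'.countP_eq (fun z => q.1.size ≤ z.size)
  rw [List.countP_cons] at hc
  have hs := (hperm.map PTree.size).sum_eq
  have hs' := (hperm'.map PTree.size).sum_eq
  rw [List.map_cons, List.sum_cons] at hs hs'
  have hlen := hperm.length_eq
  rw [List.length_cons] at hlen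
  have hq1 : q.1.size ≤ q'.1.size := by
    obtain ⟨z, hz, hzs⟩ := List.countP_pos_iff.1 (show 0 < q.2.countP
      (fun z => q.1.size ≤ z.size) by omega)
    rw [decide_eq_true_eq] at hzs
    exact hzs.trans (hmax z hz)
  refine ⟨q, hq, q', hq', hτ, ?_, ?_, ?_⟩
  · split_ifs at hc <;> omega
  · have h1 := sum_size_le_length_mul hmax
    have h2 := q'.1.one_le_size
    rw [PTree.size_node, ← hs, ← hlen]
    nlinarith
  · rw [PTree.size_node]
    omega

end Rank

namespace IsCriticalLaw

variable {p : ℕ → ℝ}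

lemma exists_tsum_wt_size_eq_le (h : IsCriticalLaw p) : ∃ C : ℝ, 0 < C ∧ ∀ m : ℕ, 1 ≤ m →
    ∑' x, (if x.size = m then wt p x else 0) ≤ ENNReal.ofReal (C / (m * √m)) := by
  obtain ⟨C, hC, hle⟩ := h.exists_walkCoeff_le
  refine ⟨C, hC, fun m hm => ?_⟩
  obtain ⟨n, rfl⟩ : ∃ n, m = n + 1 := ⟨m - 1, by omega⟩
  rw [tsum_wt_size_eq h.nonneg n]
  refine ENNReal.ofReal_le_ofReal ?_
  have hn : (0 : ℝ) < (n : ℝ) + 1 := by positivity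
  push_cast
  calc 1 / ((n : ℝ) + 1) * walkCoeff p (n + 1) n
      ≤ 1 / ((n : ℝ) + 1) * (C / √((n + 1 : ℕ) + 1)) := by gcongr; exact hle _ _
    _ ≤ 1 / ((n : ℝ) + 1) * (C / √((n : ℝ) + 1)) := by
        push_cast
        gcongr
        linarith
    _ = C / (((n : ℝ) + 1) * √((n : ℝ) + 1)) := by rw [div_mul_div_comm, one_mul]

lemma inv_mul_sqrt_le {m : ℝ} (hm : 1 ≤ m) :
    1 / (m * √m) ≤ 4 * (1 / √m - 1 / √(m + 1)) := by
  have ha : 0 < √m := Real.sqrt_pos.2 (by linarith)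
  have hb : 0 < √(m + 1) := Real.sqrt_pos.2 (by linarith)
  have ha2 : √m ^ 2 = m := Real.sq_sqrt (by linarith)
  have hb2 : √(m + 1) ^ 2 = m + 1 := Real.sq_sqrt (by linarith)
  set a := √m
  set b := √(m + 1)
  have hba : b ≤ 3 / 2 * a := by
    refine le_of_sq_le_sq ?_ (by positivity)
    nlinarith
  have key : b ≤ 4 * a ^ 2 * (b - a) := by
    refine le_of_mul_le_mul_right (a := a + b) ?_ (by positivity)
    have e : 4 * a ^ 2 * (b - a) * (a + b) = 4 * a ^ 2 := by
      have : (b - a) * (a + b) = 1 := by nlinarith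
      rw [mul_assoc, this, mul_one]
    rw [e]
    nlinarith
  rw [← ha2, div_sub_div _ _ ha.ne' hb.ne', ← mul_div_assoc, div_le_div_iff₀ (by positivity)
    (by positivity)]
  nlinarith [mul_le_mul_of_nonneg_left key ha.le]

lemma exists_tsum_wt_le_size_le (h : IsCriticalLaw p) : ∃ C : ℝ, 0 < C ∧ ∀ N : ℕ, 1 ≤ N →
    ∑' x, (if N ≤ x.size then wt p x else 0) ≤ ENNReal.ofReal (C / √N) := by
  obtain ⟨C, hC, hle⟩ := h.exists_tsum_wt_size_eq_le
  refine ⟨4 * C, by positivity, fun N hN => ?_⟩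
  have hN1 : (1 : ℝ) ≤ N := by exact_mod_cast hN
  have e : ∀ x : PTree, (if N ≤ x.size then wt p x else 0) =
      ∑' j : ℕ, if x.size = N + j then wt p x else 0 := by
    intro x
    split_ifs with hx
    · rw [tsum_eq_single (x.size - N)]
      · rw [if_pos (by omega)]
      · intro j hj
        rw [if_neg (by omega)]
    · symm
      rw [ENNReal.tsum_eq_zero]
      intro j
      rw [if_neg (by omega)]
  simp_rw [e]
  rw [ENNReal.tsum_comm]
  refine ENNReal.tsum_le_of_sum_range_le fun J => ?_
  have hterm : ∀ j ∈ range J, ∑' x, (if x.size = N + j then wt p x else 0) ≤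
      ENNReal.ofReal (4 * C * (1 / √((N : ℝ) + j) - 1 / √((N : ℝ) + (j + 1 : ℕ)))) := by
    intro j _
    refine (hle (N + j) (by omega)).trans (ENNReal.ofReal_le_ofReal ?_)
    have := inv_mul_sqrt_le (m := (N : ℝ) + j) (by linarith [Nat.cast_nonneg (α := ℝ) j])
    push_cast
    rw [← add_assoc]
    calc C / (((N : ℝ) + j) * √((N : ℝ) + j)) = C * (1 / (((N : ℝ) + j) * √((N : ℝ) + j))) := by
          rw [mul_one_div]
      _ ≤ C * (4 * (1 / √((N : ℝ) + j) - 1 / √((N : ℝ) + j + 1))) := by gcongr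
      _ = _ := by ring
  refine (sum_le_sum hterm).trans ?_
  rw [← ENNReal.ofReal_sum_of_nonneg]
  · refine ENNReal.ofReal_le_ofReal ?_
    rw [← mul_sum, sum_range_sub' (fun j : ℕ => 1 / √((N : ℝ) + j)),
      ← mul_one_div (4 * C) √(N : ℝ)]
    refine mul_le_mul_of_nonneg_left ?_ (by positivity)
    simp only [Nat.cast_zero, add_zero]
    linarith [show 0 ≤ 1 / √((N : ℝ) + J) by positivity]
  · intro j _
    have : 1 / √((N : ℝ) + (j + 1 : ℕ)) ≤ 1 / √((N : ℝ) + j) := by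
      refine one_div_le_one_div_of_le (Real.sqrt_pos.2 (by positivity)) ?_
      gcongr
      omega
    have := sub_nonneg.2 this
    positivity

lemma tsum_ofReal_mul_natCast_pow_ne_top (h : IsCriticalLaw p) {a b : ℕ} (ha : 1 ≤ a) (hab : a ≤ b)
    (hs : Summable fun i : ℕ => (i : ℝ) ^ b * p i) :
    ∑' i : ℕ, ENNReal.ofReal (p i) * (i : ℝ≥0∞) ^ a ≠ ⊤ := by
  have hs' : Summable fun i : ℕ => p i * (i : ℝ) ^ a := by
    refine Summable.of_nonneg_of_le (fun i => mul_nonneg (h.nonneg i) (by positivity))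
      (fun i => ?_) hs
    rw [mul_comm]
    refine mul_le_mul_of_nonneg_right ?_ (h.nonneg i)
    rcases Nat.eq_zero_or_pos i with rfl | hi
    · simp [show a ≠ 0 by omega]
    · exact pow_le_pow_right₀ (by exact_mod_cast hi) hab
  have e : ∀ i : ℕ, ENNReal.ofReal (p i) * (i : ℝ≥0∞) ^ a = ENNReal.ofReal (p i * (i : ℝ) ^ a) := by
    intro i
    rw [ENNReal.ofReal_mul (h.nonneg i), ENNReal.ofReal_pow (by positivity), ENNReal.ofReal_natCast]
  simp_rw [e]
  exact hs'.tsum_ofReal_ne_top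

open Classical in
lemma exists_tallPick_le (h : IsCriticalLaw p) {j b : ℕ} (hj : j + 1 ≤ b)
    (hs : Summable fun i : ℕ => (i : ℝ) ^ b * p i) :
    ∃ K : ℝ, 0 < K ∧ ∀ τ : ℕ, 1 ≤ τ →
      ∑' T, wt p T * (if HasTallPick τ j T then 1 else 0) ≤
        ENNReal.ofReal (K / τ ^ (j + 1)) := by
  obtain ⟨C, hC, htail⟩ := h.exists_tsum_wt_le_size_le
  obtain ⟨K, hK, htall⟩ := h.exists_tall_weighted_le j
  have hM := h.tsum_ofReal_mul_natCast_pow_ne_top (by omega : 1 ≤ j + 1) hj hs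
  set M := ∑' i : ℕ, ENNReal.ofReal (p i) * (i : ℝ≥0∞) ^ (j + 1) with hMdef
  refine ⟨M.toReal * C ^ j * K + 1, by positivity, fun τ hτ => ?_⟩
  have hτ0 : (0 : ℝ) < τ := by exact_mod_cast hτ
  set A := ENNReal.ofReal (K / τ ^ (j + 1))
  have hlist : ∀ d : ℕ, listSum (wt p) d
      (fun L => if HasTallPick τ j (.node L) then 1 else 0) ≤
        (d : ℝ≥0∞) ^ (j + 1) * (ENNReal.ofReal C ^ j * A) := by
    intro d
    rcases d with _ | d
    · rw [listSum]
      rw [if_neg]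
      · exact zero_le
      · rintro ⟨q, hq, -⟩
        simp [PTree.children, picks] at hq
    calc listSum (wt p) (d + 1) (fun L => if HasTallPick τ j (.node L) then 1 else 0)
        ≤ listSum (wt p) (d + 1) (fun L => ((picks L).map fun q =>
            (if τ ≤ q.1.height then 1 else 0) *
              (if j ≤ q.2.countP (fun z => q.1.size ≤ z.size) then (1 : ℝ≥0∞) else 0)).sum) := by
          refine listSum_mono fun L _ => ?_
          split_ifs with hL
          · obtain ⟨q, hq, h1, h2⟩ := hL
            refine le_trans ?_ (List.single_le_sum (fun _ _ => zero_le) _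
              (List.mem_map.2 ⟨q, hq, rfl⟩))
            rw [if_pos h1, if_pos h2, one_mul]
          · exact zero_le
      _ = (d + 1) * ∑' x, wt p x * listSum (wt p) d (fun L =>
            (if τ ≤ x.height then 1 else 0) *
              (if j ≤ L.countP (fun z => x.size ≤ z.size) then (1 : ℝ≥0∞) else 0)) :=
          listSum_picks (wt p) d _
      _ ≤ (d + 1) * ∑' x, wt p x * ((if τ ≤ x.height then 1 else 0) *
            ((d + 1) ^ j * ENNReal.ofReal C ^ j * ENNReal.ofReal (1 / √x.size) ^ j)) := by
          gcongr with x
          rw [listSum_mul_left]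
          gcongr
          refine (listSum_countP_le (wt p) h.tsum_wt_le_one _ d j).trans ?_
          rw [← mul_pow, ← mul_pow]
          refine pow_le_pow_left' ?_ j
          rw [mul_assoc, ← ENNReal.ofReal_mul hC.le, mul_one_div]
          simp only [decide_eq_true_eq]
          gcongr
          · exact le_self_add
          · exact htail _ x.one_le_size
      _ = (d + 1) * ((d + 1) ^ j * ENNReal.ofReal C ^ j *
            ∑' x, wt p x * ((if τ ≤ x.height then 1 else 0) * ENNReal.ofReal (1 / √x.size) ^ j)) := by
          congr 1
          rw [← ENNReal.tsum_mul_left]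
          refine tsum_congr fun x => ?_
          ring
      _ ≤ (d + 1) * ((d + 1) ^ j * ENNReal.ofReal C ^ j * A) := by
          gcongr
          exact htall τ hτ
      _ = _ := by
          push_cast
          ring
  rw [tsum_wt_mul h.nonneg]
  calc _ ≤ ∑' d : ℕ, ENNReal.ofReal (p d) * ((d : ℝ≥0∞) ^ (j + 1) * (ENNReal.ofReal C ^ j * A)) := by
        gcongr with d
        exact hlist d
    _ = M * (ENNReal.ofReal C ^ j * A) := by
        simp_rw [← mul_assoc, hMdef, ENNReal.tsum_mul_right]
    _ = ENNReal.ofReal (M.toReal * (C ^ j * (K / τ ^ (j + 1)))) := by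
        rw [ENNReal.ofReal_mul ENNReal.toReal_nonneg, ENNReal.ofReal_toReal hM,
          ENNReal.ofReal_mul (by positivity), ENNReal.ofReal_pow hC.le]
    _ ≤ _ := by
        refine ENNReal.ofReal_le_ofReal ?_
        rw [show M.toReal * (C ^ j * (K / τ ^ (j + 1))) =
          (M.toReal * C ^ j * K) / τ ^ (j + 1) by ring]
        gcongr
        linarith

end IsCriticalLaw

namespace IsCriticalLaw

variable {p : ℕ → ℝ}

lemma exists_tsum_wt_giant_le (h : IsCriticalLaw p) : ∃ C : ℝ, 0 < C ∧ ∀ d m s : ℕ, 1 ≤ m →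
    ∑' y, wt p y * (if m ≤ 2 * d * y.size ∧ m = s + y.size then 1 else 0) ≤
      (d : ℝ≥0∞) ^ 2 * ENNReal.ofReal (C / (m * √m)) := by
  obtain ⟨C, hC, hle⟩ := h.exists_tsum_wt_size_eq_le
  refine ⟨4 * C, by positivity, fun d m s hm => ?_⟩
  have hm0 : (0 : ℝ) < m := by exact_mod_cast hm
  by_cases hM : s < m ∧ m ≤ 2 * d * (m - s)
  · have hM1 : 1 ≤ m - s := by omega
    have hM0 : (0 : ℝ) < (m - s : ℕ) := by exact_mod_cast hM1
    have hmM : (m : ℝ) ≤ 2 * d * (m - s : ℕ) := by exact_mod_cast hM.2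
    have hd : 1 ≤ d := by
      by_contra hd
      obtain rfl : d = 0 := by omega
      simp at hM
      omega
    have hd1 : (1 : ℝ) ≤ d := by exact_mod_cast hd
    calc _ ≤ ∑' y, (if y.size = m - s then wt p y else 0) := by
          refine ENNReal.tsum_le_tsum fun y => ?_
          split_ifs <;> simp
          omega
      _ ≤ ENNReal.ofReal (C / ((m - s : ℕ) * √(m - s : ℕ))) := hle _ hM1
      _ ≤ ENNReal.ofReal ((d : ℝ) ^ 2 * (4 * C / (m * √m))) := by
          refine ENNReal.ofReal_le_ofReal ?_
          rw [← mul_div_assoc, div_le_div_iff₀ (by positivity) (by positivity)]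
          have h1 : √(m : ℝ) ≤ 2 * d * √(m - s : ℕ) := by
            calc √(m : ℝ) ≤ √((2 * d) ^ 2 * (m - s : ℕ)) := by
                  refine Real.sqrt_le_sqrt (hmM.trans ?_)
                  gcongr
                  nlinarith
              _ = 2 * d * √(m - s : ℕ) := by
                  rw [Real.sqrt_mul (by positivity), Real.sqrt_sq (by positivity)]
          calc C * (m * √m) ≤ C * ((2 * d * (m - s : ℕ)) * (2 * d * √(m - s : ℕ))) := by gcongr
            _ = _ := by ring
      _ = _ := by
          rw [ENNReal.ofReal_mul (by positivity), ENNReal.ofReal_pow (by positivity),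
            ENNReal.ofReal_natCast]
  · refine le_of_eq_of_le ?_ zero_le
    rw [ENNReal.tsum_eq_zero]
    intro y
    rw [if_neg, mul_zero]
    rintro ⟨h1, h2⟩
    have := y.one_le_size
    rw [show y.size = m - s by omega] at h1
    exact hM ⟨by omega, h1⟩

open Classical in
lemma listSum_tallPick_le (τ j m D : ℕ) :
    listSum (wt p) (D + 2)
        (fun L => if (PTree.node L).size = m ∧ HasTallPick τ (j + 1) (.node L) then 1 else 0) ≤
      (D + 2) * ∑' x, wt p x * ((D + 1) * listSum (wt p) D fun L =>
        (if τ ≤ x.height then 1 else 0) *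
          (if j ≤ L.countP (fun z => x.size ≤ z.size) then 1 else 0) *
          ∑' y, wt p y * (if m ≤ 2 * (D + 2) * y.size ∧
            m = (1 + x.size + (L.map PTree.size).sum) + y.size then 1 else 0)) := by
  set F : PTree → PTree → List PTree → ℝ≥0∞ := fun x y L =>
    (if τ ≤ x.height then 1 else 0) *
      (if j ≤ L.countP (fun z => x.size ≤ z.size) then 1 else 0) *
      (if m ≤ 2 * (D + 2) * y.size ∧
        m = (1 + x.size + (L.map PTree.size).sum) + y.size then 1 else 0) with hF
  calc _ ≤ listSum (wt p) (D + 1 + 1) (fun L => ((picks L).map fun q =>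
          ((picks q.2).map fun q' => F q.1 q'.1 q'.2).sum).sum) := by
        refine listSum_mono fun L hL => ?_
        split_ifs with hT
        · obtain ⟨hsize, hT⟩ := hT
          obtain ⟨q, hq, q', hq', h1, h2, h3, h4⟩ := exists_giant_of_hasTallPick hT
          refine le_trans ?_ (List.single_le_sum (fun _ _ => zero_le) _
            (List.mem_map.2 ⟨q, hq, rfl⟩))
          refine le_trans ?_ (List.single_le_sum (fun _ _ => zero_le) _
            (List.mem_map.2 ⟨q', hq', rfl⟩))
          rw [hsize, hL] at h3
          simp only [hF]
          rw [if_pos h1, if_pos h2, if_pos ⟨h3, by omega⟩]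
          simp
        · exact zero_le
    _ = (D + 1 + 1 : ℕ) * ∑' x, wt p x * ((D + 1) * ∑' y, wt p y * listSum (wt p) D (F x y)) := by
        rw [listSum_picks]
        push_cast
        congr 1
        refine tsum_congr fun x => ?_
        rw [listSum_picks (wt p) D fun q' => F x q'.1 q'.2]
    _ = _ := by
        push_cast
        rw [show (D : ℝ≥0∞) + 1 + 1 = D + 2 by ring]
        congr 1
        refine tsum_congr fun x => ?_
        congr 2
        simp_rw [← listSum_mul_left]
        rw [← listSum_tsum]
        congr 1
        funext L
        rw [← ENNReal.tsum_mul_left]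
        refine tsum_congr fun y => ?_
        simp only [hF]
        ring

open Classical in
lemma exists_tallPick_size_le (h : IsCriticalLaw p) {j b : ℕ} (hj : j + 4 ≤ b)
    (hs : Summable fun i : ℕ => (i : ℝ) ^ b * p i) :
    ∃ K : ℝ, 0 < K ∧ ∀ τ m : ℕ, 1 ≤ τ → 1 ≤ m →
      ∑' T, wt p T * (if T.size = m ∧ HasTallPick τ (j + 1) T then 1 else 0) ≤
        ENNReal.ofReal (K / (m * √m * τ ^ (j + 1))) := by
  obtain ⟨C, hC, htail⟩ := h.exists_tsum_wt_le_size_le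
  obtain ⟨K, hK, htall⟩ := h.exists_tall_weighted_le j
  obtain ⟨B, hB, hgiant⟩ := h.exists_tsum_wt_giant_le
  have hM := h.tsum_ofReal_mul_natCast_pow_ne_top (by omega : 1 ≤ j + 4) hj hs
  set M := ∑' i : ℕ, ENNReal.ofReal (p i) * (i : ℝ≥0∞) ^ (j + 4) with hMdef
  refine ⟨M.toReal * B * C ^ j * K + 1, by positivity, fun τ m hτ hm => ?_⟩
  have hτ0 : (0 : ℝ) < τ := by exact_mod_cast hτ
  have hm0 : (0 : ℝ) < m := by exact_mod_cast hm
  set A := ENNReal.ofReal (K / τ ^ (j + 1))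
  set R := ENNReal.ofReal (B / (m * √m))
  have hlist : ∀ d : ℕ, listSum (wt p) d
      (fun L => if (PTree.node L).size = m ∧ HasTallPick τ (j + 1) (.node L) then 1 else 0) ≤
        (d : ℝ≥0∞) ^ (j + 4) * (R * (ENNReal.ofReal C ^ j * A)) := by
    intro d
    rcases d with _ | _ | D
    · rw [listSum, if_neg]
      · exact zero_le
      · rintro ⟨-, q, hq, -⟩
        simp [PTree.children, picks] at hq
    · rw [listSum_congr (G := fun _ => 0), listSum_zero]
      · exact zero_le
      · intro L hL
        rw [if_neg]
        rintro ⟨-, hT⟩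
        obtain ⟨q, hq, q', hq', -⟩ := exists_giant_of_hasTallPick hT
        have h1 := (perm_of_mem_picks hq).length_eq
        have h2 := (perm_of_mem_picks hq').length_eq
        simp only [List.length_cons] at h1 h2
        omega
    calc _ ≤ _ := listSum_tallPick_le τ j m D
      _ ≤ (D + 2) * ∑' x, wt p x * ((D + 2) * ((if τ ≤ x.height then 1 else 0) *
            ((D + 2) ^ j * ENNReal.ofReal C ^ j * ENNReal.ofReal (1 / √x.size) ^ j) *
              ((D + 2) ^ 2 * R))) := by
          gcongr with x
          · norm_num
          calc _ ≤ listSum (wt p) D fun L => ((if τ ≤ x.height then 1 else 0) * ((D + 2) ^ 2 * R)) *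
                (if j ≤ L.countP (fun z => x.size ≤ z.size) then 1 else 0) := by
                refine listSum_mono fun L _ => ?_
                rw [mul_right_comm]
                gcongr
                have := hgiant (D + 2) m (1 + x.size + (L.map PTree.size).sum) hm
                push_cast at this
                exact this
            _ ≤ ((if τ ≤ x.height then 1 else 0) * ((D + 2) ^ 2 * R)) *
                ((D + 2) ^ j * ENNReal.ofReal C ^ j * ENNReal.ofReal (1 / √x.size) ^ j) := by
                rw [listSum_mul_left]
                gcongr
                refine (listSum_countP_le (wt p) h.tsum_wt_le_one _ D j).trans ?_
                rw [← mul_pow, ← mul_pow]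
                refine pow_le_pow_left' ?_ j
                rw [mul_assoc, ← ENNReal.ofReal_mul hC.le, mul_one_div]
                simp only [decide_eq_true_eq]
                gcongr
                · exact le_self_add
                · exact htail _ x.one_le_size
            _ = _ := by ring
      _ = (D + 2) ^ (j + 4) * R * ENNReal.ofReal C ^ j *
            ∑' x, wt p x * ((if τ ≤ x.height then 1 else 0) * ENNReal.ofReal (1 / √x.size) ^ j) := by
          rw [← ENNReal.tsum_mul_left, ← ENNReal.tsum_mul_left]
          refine tsum_congr fun x => ?_
          ring
      _ ≤ (D + 2) ^ (j + 4) * R * ENNReal.ofReal C ^ j * A := by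
          gcongr
          exact htall τ hτ
      _ = _ := by
          push_cast
          rw [show (D : ℝ≥0∞) + 1 + 1 = D + 2 by ring]
          ring
  rw [tsum_wt_mul h.nonneg]
  calc _ ≤ ∑' d : ℕ, ENNReal.ofReal (p d) *
          ((d : ℝ≥0∞) ^ (j + 4) * (R * (ENNReal.ofReal C ^ j * A))) := by
        gcongr with d
        exact hlist d
    _ = M * (R * (ENNReal.ofReal C ^ j * A)) := by
        simp_rw [← mul_assoc, hMdef, ENNReal.tsum_mul_right]
    _ = ENNReal.ofReal (M.toReal * (B / (m * √m) * (C ^ j * (K / τ ^ (j + 1))))) := by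
        rw [ENNReal.ofReal_mul ENNReal.toReal_nonneg, ENNReal.ofReal_toReal hM,
          ENNReal.ofReal_mul (by positivity), ENNReal.ofReal_mul (by positivity),
          ENNReal.ofReal_pow hC.le]
    _ ≤ _ := by
        refine ENNReal.ofReal_le_ofReal ?_
        rw [show M.toReal * (B / (m * √m) * (C ^ j * (K / τ ^ (j + 1)))) =
          (M.toReal * B * C ^ j * K) / (m * √m * τ ^ (j + 1)) by field_simp]
        gcongr
        linarith

end IsCriticalLaw

lemma sum_range_inv_sqrt_le (n : ℕ) : ∑ i ∈ range n, 1 / √((i : ℝ) + 1) ≤ 2 * √n := by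
  induction n with
  | zero => simp
  | succ n ih =>
    rw [sum_range_succ]
    push_cast
    have hb : 0 < √((n : ℝ) + 1) := Real.sqrt_pos.2 (by positivity)
    have ha : 0 ≤ √(n : ℝ) := Real.sqrt_nonneg _
    have ha2 : √(n : ℝ) ^ 2 = n := Real.sq_sqrt (by positivity)
    have hb2 : √((n : ℝ) + 1) ^ 2 = n + 1 := Real.sq_sqrt (by positivity)
    have : 1 / √((n : ℝ) + 1) ≤ 2 * (√((n : ℝ) + 1) - √n) := by
      rw [div_le_iff₀ hb]
      nlinarith [sq_nonneg (√((n : ℝ) + 1) - √n)]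
    linarith

lemma tsum_weight_subtype {p : ℕ → ℝ} (hp : ∀ i, 0 ≤ p i) (Q : PTree → Prop) [DecidablePred Q] :
    ∑' T : {T // Q T}, weight p T.1 = (∑' x, if Q x then wt p x else 0).toReal := by
  rw [ENNReal.tsum_toReal_eq (fun x => by split_ifs <;> simp [wt])]
  refine (tsum_subtype {T | Q T} (weight p)).trans (tsum_congr fun x => ?_)
  simp only [Set.indicator_apply, Set.mem_ofPred_eq]
  split_ifs
  · rw [wt, ENNReal.toReal_ofReal (weight_nonneg hp x)]
  · simp

lemma treeSum_eq {p : ℕ → ℝ} (hp : ∀ i, 0 ≤ p i) {n : ℕ} (hn : 1 ≤ n) :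
    treeSum p n = 1 / n * walkCoeff p n (n - 1) := by
  obtain ⟨m, rfl⟩ : ∃ m, n = m + 1 := ⟨n - 1, by omega⟩
  rw [treeSum, tsum_weight_subtype hp, tsum_wt_size_eq hp, ENNReal.toReal_ofReal]
  · push_cast
    rfl
  · exact mul_nonneg (by positivity) (walkCoeff_nonneg hp _ _)

namespace IsCriticalLaw

variable {p : ℕ → ℝ}

open Classical in
lemma exists_tsum_tallPick_walkCoeff_le (h : IsCriticalLaw p) {j : ℕ}
    (hs : Summable fun i : ℕ => (i : ℝ) ^ (j + 4) * p i) :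
    ∃ K : ℝ, 0 < K ∧ ∀ τ n : ℕ, 1 ≤ τ → 1 ≤ n →
      ∑' x, wt p x * ((if HasTallPick τ (j + 1) x then 1 else 0) *
        if x.size ≤ n then ENNReal.ofReal (walkCoeff p (n - x.size) (n - x.size)) else 0) ≤
        ENNReal.ofReal (K * (1 / (√n * τ ^ (j + 2)) + 1 / (n * τ ^ (j + 1)))) := by
  obtain ⟨C, hC, hwalk⟩ := h.exists_walkCoeff_le
  obtain ⟨K, hK, hall⟩ := h.exists_tallPick_le (by omega : j + 1 + 1 ≤ j + 4) hs
  obtain ⟨B, hB, hsize⟩ := h.exists_tallPick_size_le le_rfl hs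
  refine ⟨2 * C * K + 8 * B * C, by positivity, fun τ n hτ hn => ?_⟩
  have hτ0 : (0 : ℝ) < τ := by exact_mod_cast hτ
  have hn0 : (0 : ℝ) < n := by exact_mod_cast hn
  have hpoint : ∀ x : PTree, (if HasTallPick τ (j + 1) x then (1 : ℝ≥0∞) else 0) *
      (if x.size ≤ n then ENNReal.ofReal (walkCoeff p (n - x.size) (n - x.size)) else 0) ≤
      (if HasTallPick τ (j + 1) x then 1 else 0) * ENNReal.ofReal (2 * C / √n) +
        ∑ i ∈ range n, (if n < 2 * (n - i) then
          (if x.size = n - i ∧ HasTallPick τ (j + 1) x then 1 else 0) *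
            ENNReal.ofReal (C / √((i : ℝ) + 1)) else 0) := by
    intro x
    have hx := x.one_le_size
    by_cases hT : HasTallPick τ (j + 1) x
    swap
    · simp [hT]
    by_cases hxn : x.size ≤ n
    swap
    · simp [hxn]
    rw [if_pos hT, if_pos hxn, one_mul, one_mul]
    by_cases hhalf : 2 * x.size ≤ n
    · refine le_add_right (ENNReal.ofReal_le_ofReal ((hwalk _ _).trans ?_))
      rw [div_le_div_iff₀ (by positivity) (by positivity)]
      have : √(n : ℝ) ≤ 2 * √((n - x.size : ℕ) + 1) := by
        rw [show (2 : ℝ) = √(2 ^ 2) by rw [Real.sqrt_sq (by norm_num)],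
          ← Real.sqrt_mul (by norm_num)]
        refine Real.sqrt_le_sqrt ?_
        have : (n : ℝ) ≤ 2 * (n - x.size : ℕ) := by exact_mod_cast (by omega)
        linarith [Nat.cast_nonneg (α := ℝ) (n - x.size)]
      calc C * √n ≤ C * (2 * √((n - x.size : ℕ) + 1)) := by gcongr
        _ = _ := by ring
    · refine le_add_left (le_trans ?_ (single_le_sum (fun _ _ => zero_le)
        (mem_range.2 (by omega : n - x.size < n))))
      rw [if_pos (by omega), if_pos ⟨by omega, hT⟩, one_mul]
      exact ENNReal.ofReal_le_ofReal (hwalk _ _)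
  have hlocal : ∀ i ∈ range n, ∑' x, wt p x * (if n < 2 * (n - i) then
          (if x.size = n - i ∧ HasTallPick τ (j + 1) x then 1 else 0) *
            ENNReal.ofReal (C / √((i : ℝ) + 1)) else 0) ≤
        ENNReal.ofReal (4 * B * C / (n * √n * τ ^ (j + 1)) * (1 / √((i : ℝ) + 1))) := by
    intro i _
    by_cases hi : n < 2 * (n - i)
    swap
    · simp [hi]
    simp only [if_pos hi, ← mul_assoc]
    rw [ENNReal.tsum_mul_right]
    calc _ ≤ ENNReal.ofReal (B / ((n - i : ℕ) * √(n - i : ℕ) * τ ^ (j + 1))) *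
          ENNReal.ofReal (C / √((i : ℝ) + 1)) := by
          gcongr
          exact hsize τ (n - i) hτ (by omega)
      _ ≤ ENNReal.ofReal (4 * B / (n * √n * τ ^ (j + 1))) *
          ENNReal.ofReal (C / √((i : ℝ) + 1)) := by
          have hm0 : (0 : ℝ) < (n - i : ℕ) := by exact_mod_cast (by omega)
          have h1 : (n : ℝ) ≤ 2 * (n - i : ℕ) := by exact_mod_cast hi.le
          have h2 : √(n : ℝ) ≤ 2 * √(n - i : ℕ) := by
            rw [show (2 : ℝ) = √(2 ^ 2) by rw [Real.sqrt_sq (by norm_num)],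
              ← Real.sqrt_mul (by norm_num)]
            refine Real.sqrt_le_sqrt ?_
            linarith
          gcongr ENNReal.ofReal ?_ * _
          rw [div_le_div_iff₀ (by positivity) (by positivity)]
          calc B * (n * √n * (τ : ℝ) ^ (j + 1))
              ≤ B * ((2 * (n - i : ℕ)) * (2 * √(n - i : ℕ)) * (τ : ℝ) ^ (j + 1)) := by gcongr
            _ = _ := by ring
      _ = _ := by
          rw [← ENNReal.ofReal_mul (by positivity)]
          congr 1
          ring
  calc _ ≤ ∑' x, wt p x * ((if HasTallPick τ (j + 1) x then 1 else 0) *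
          ENNReal.ofReal (2 * C / √n) +
        ∑ i ∈ range n, (if n < 2 * (n - i) then
          (if x.size = n - i ∧ HasTallPick τ (j + 1) x then 1 else 0) *
            ENNReal.ofReal (C / √((i : ℝ) + 1)) else 0)) := by
        gcongr with x
        exact hpoint x
    _ = (∑' x, wt p x * (if HasTallPick τ (j + 1) x then 1 else 0)) *
          ENNReal.ofReal (2 * C / √n) +
        ∑ i ∈ range n, ∑' x, wt p x * (if n < 2 * (n - i) then
          (if x.size = n - i ∧ HasTallPick τ (j + 1) x then 1 else 0) *
            ENNReal.ofReal (C / √((i : ℝ) + 1)) else 0) := by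
        simp_rw [mul_add, mul_sum]
        rw [ENNReal.tsum_add, Summable.tsum_finsetSum fun _ _ => ENNReal.summable,
          ← ENNReal.tsum_mul_right]
        simp_rw [mul_assoc]
    _ ≤ ENNReal.ofReal (K / τ ^ (j + 1 + 1)) * ENNReal.ofReal (2 * C / √n) +
        ∑ i ∈ range n,
          ENNReal.ofReal (4 * B * C / (n * √n * τ ^ (j + 1)) * (1 / √((i : ℝ) + 1))) := by
        gcongr with i hi
        · exact hall τ hτ
        · exact hlocal i hi
    _ = ENNReal.ofReal (K / τ ^ (j + 1 + 1) * (2 * C / √n) +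
          4 * B * C / (n * √n * τ ^ (j + 1)) * ∑ i ∈ range n, 1 / √((i : ℝ) + 1)) := by
        rw [mul_sum, ENNReal.ofReal_add (by positivity) (sum_nonneg fun _ _ => by positivity),
          ENNReal.ofReal_mul (by positivity),
          ENNReal.ofReal_sum_of_nonneg fun _ _ => by positivity]
    _ ≤ _ := by
        refine ENNReal.ofReal_le_ofReal ?_
        have hsq : 0 < √(n : ℝ) := Real.sqrt_pos.2 hn0
        calc _ ≤ K / τ ^ (j + 1 + 1) * (2 * C / √n) +
              4 * B * C / (n * √n * τ ^ (j + 1)) * (2 * √n) := by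
              gcongr
              exact sum_range_inv_sqrt_le n
          _ = 2 * C * K * (1 / (√n * τ ^ (j + 2))) + 8 * B * C * (1 / (n * τ ^ (j + 1))) := by
              field_simp
              ring
          _ ≤ _ := by
              rw [mul_add]
              gcongr
              · linarith [show 0 ≤ 8 * B * C by positivity]
              · linarith [show 0 ≤ 2 * C * K by positivity]

end IsCriticalLaw

lemma MomentFinite.summable_pow {p : ℕ → ℝ} {k : ℕ} (h : MomentFinite p ((k : ℝ) + 2)) :
    Summable fun i : ℕ => (i : ℝ) ^ (k + 2) * p i := by
  refine Summable.congr h fun i => ?_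
  rw [← Real.rpow_natCast]
  norm_num

/-- tail bound for the maximal height of a subtree hanging off any node
of `τ_n` at rank `≥ k`. -/
theorem stmt_15 (p : ℕ → ℝ)
    (hp_nonneg : ∀ i, 0 ≤ p i)
    (hp_sum : ∑' i : ℕ, p i = 1)
    (hp_mean : ∑' i : ℕ, (i : ℝ) * p i = 1)
    (hp_sq : Summable (fun i : ℕ => (i : ℝ) ^ 2 * p i))
    (hp_var : 1 < ∑' i : ℕ, (i : ℝ) ^ 2 * p i)
    (k : ℕ) (hk : 2 ≤ k)
    (hmom : MomentFinite p ((k : ℝ) + 2)) :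
    ∃ C : ℝ, 0 < C ∧ ∀ t : ℝ, 1 ≤ t → ∀ n ∈ gwSupport p,
      condProb p n
          (fun T => ∃ v ∈ T.subtrees, ∃ ℓ : ℕ, k ≤ ℓ ∧ t ≤ (Hstar v ℓ : ℝ)) ≤
        C * ((n : ℝ) * t ^ (-(k : ℝ)) + Real.sqrt n * t ^ (-((k : ℝ) - 1))) := by
  classical
  have h : IsCriticalLaw p := ⟨hp_nonneg, hp_sum, hp_mean, hp_sq, hp_var⟩
  obtain ⟨j, rfl⟩ : ∃ j, k = j + 2 := ⟨k - 2, by omega⟩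
  obtain ⟨K, hK, hmarked⟩ := h.exists_tsum_tallPick_walkCoeff_le hmom.summable_pow
  obtain ⟨c, hc, hlower⟩ := h.exists_le_walkCoeff
  refine ⟨K / c, by positivity, fun t ht n hn => ?_⟩
  obtain ⟨hn1, hpos⟩ := hn
  have hn0 : (0 : ℝ) < n := by exact_mod_cast hn1
  have ht0 : 0 < t := by linarith
  have hsq : 0 < √(n : ℝ) := Real.sqrt_pos.2 hn0
  have hτ : 1 ≤ ⌈t⌉₊ := Nat.one_le_ceil_iff.2 ht0
  have htτ : t ≤ (⌈t⌉₊ : ℝ) := Nat.le_ceil t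
  have hnum : ∑' x, (if x.size = n ∧ ∃ v ∈ x.subtrees, ∃ ℓ : ℕ, j + 2 ≤ ℓ ∧ t ≤ (Hstar v ℓ : ℝ)
      then wt p x else 0) ≤
        ENNReal.ofReal (K * (1 / (√n * (⌈t⌉₊ : ℝ) ^ (j + 2)) + 1 / (n * (⌈t⌉₊ : ℝ) ^ (j + 1)))) := by
    refine le_trans ?_ (hmarked ⌈t⌉₊ n hτ hn1)
    rw [← tsum_wt_marked hp_nonneg]
    refine ENNReal.tsum_le_tsum fun x => ?_
    by_cases hx : x.size = n
    swap
    · simp [hx]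
    rw [if_pos hx]
    split_ifs with hE
    · obtain ⟨-, v, hv, ℓ, hℓ, hH⟩ := hE
      refine le_mul_of_one_le_right zero_le (le_trans ?_ (List.single_le_sum
        (fun _ _ => zero_le) _ (List.mem_map.2 ⟨v, hv, rfl⟩)))
      have hT : HasTallPick ⌈t⌉₊ (j + 1) v := hasTallPick_of_le_Hstar ht hℓ hH
      rw [if_pos hT]
    · exact zero_le
  rw [treeSum_eq hp_nonneg hn1] at hpos
  have hden : c / (n * √n) ≤ treeSum p n := by
    rw [treeSum_eq hp_nonneg hn1]
    calc c / (n * √n) = 1 / n * (c / √n) := by rw [div_mul_div_comm, one_mul]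
      _ ≤ _ := by
        gcongr
        exact hlower n hn1 (pos_of_mul_pos_right hpos (by positivity))
  rw [condProb, tsum_weight_subtype hp_nonneg]
  have h1 : t ^ (-((j + 2 : ℕ) : ℝ)) = 1 / t ^ (j + 2) := by
    rw [Real.rpow_neg ht0.le, Real.rpow_natCast, one_div]
  have h2 : t ^ (-(((j + 2 : ℕ) : ℝ) - 1)) = 1 / t ^ (j + 1) := by
    rw [show ((j + 2 : ℕ) : ℝ) - 1 = (j + 1 : ℕ) by push_cast; ring, Real.rpow_neg ht0.le,
      Real.rpow_natCast, one_div]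
  rw [h1, h2]
  calc _ ≤ (K * (1 / (√n * (⌈t⌉₊ : ℝ) ^ (j + 2)) + 1 / (n * (⌈t⌉₊ : ℝ) ^ (j + 1)))) /
        (c / (n * √n)) := by
        gcongr
        exact ENNReal.toReal_le_of_le_ofReal (by positivity) hnum
    _ ≤ (K * (1 / (√n * t ^ (j + 2)) + 1 / (n * t ^ (j + 1)))) / (c / (n * √n)) := by
        gcongr
    _ = _ := by
        field_simp
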